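/- Let (X_i,Y_i) be i.i.d. from a finite distribution P with H = H(Y|X), σ² = Var(log P(Y|X)) > 0, and ρ = E[|log P(Y|X) + H|³] < ∞. Let Γ_n be a set predictor with P((Y_1,...,Y_n) ∉ Γ_n) ≤ α. Then for any Δ > 0 with α + ρ/(√n σ³) + Δ ∈ [0,1]: log E[|Γ_n|] ≥ log Δ + nH + √n·σ·Q⁻¹(α + ρ/(√n σ³) + Δ), where Q is the standard Gaussian complementary CDF. -/

import Mathlib

/-- The standard Gaussian complementary CDF `Q(t) = P(N(0,1) > t)`. -/
noncomputable def gaussQ (t : ℝ) : ℝ :=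
  (Real.sqrt (2 * Real.pi))⁻¹ * ∫ u in Set.Ioi t, Real.exp (-u ^ 2 / 2)

/-- Kernel appearing in the Prawitz smoothing inequality (sine part). -/
noncomputable def prawitzKernel (u : ℝ) : ℝ :=
  (1 - u) * (Real.cos (Real.pi * u) / Real.sin (Real.pi * u)) + 1 / Real.pi

theorem mul_cos_le_mul_sin {x : ℝ} (hx0 : 0 ≤ x) (hx : x ≤ Real.pi) :
    x * Real.cos x ≤ (1 - x ^ 2 / 3) * Real.sin x := by
  have key : MonotoneOn (fun x : ℝ => (1 - x ^ 2 / 3) * Real.sin x - x * Real.cos x)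
      (Set.Icc 0 Real.pi) := by
    apply monotoneOn_of_deriv_nonneg (convex_Icc _ _) (by fun_prop) (by fun_prop)
    intro y hy
    rw [interior_Icc] at hy
    have hd : HasDerivAt (fun x : ℝ => (1 - x ^ 2 / 3) * Real.sin x - x * Real.cos x)
        (y / 3 * (Real.sin y - y * Real.cos y)) y := by
      have h1 : HasDerivAt (fun x : ℝ => 1 - x ^ 2 / 3) (-(2 * y / 3)) y := by
        exact (((hasDerivAt_pow 2 y).div_const 3).const_sub 1).congr_deriv (by norm_num)
      exact ((h1.mul (Real.hasDerivAt_sin y)).sub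
        ((hasDerivAt_id y).mul (Real.hasDerivAt_cos y))).congr_deriv (by simp only [id]; ring)
    rw [hd.deriv]
    have h2 : y * Real.cos y ≤ Real.sin y := by
      rcases lt_or_ge y (Real.pi / 2) with h | h
      · have hc : 0 < Real.cos y := Real.cos_pos_of_mem_Ioo ⟨by linarith [hy.1, Real.pi_pos], h⟩
        have := (Real.lt_tan hy.1 h).le
        rwa [Real.tan_eq_sin_div_cos, le_div_iff₀ hc] at this
      · have hc : Real.cos y ≤ 0 :=
          Real.cos_nonpos_of_pi_div_two_le_of_le h (by linarith [hy.2, Real.pi_pos])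
        have hs := Real.sin_pos_of_pos_of_lt_pi hy.1 hy.2
        nlinarith [hy.1]
    have := hy.1
    have : 0 ≤ y / 3 := by linarith
    exact mul_nonneg this (by linarith)
  have := key ⟨le_rfl, Real.pi_pos.le⟩ ⟨hx0, hx⟩ hx0
  simp at this
  linarith

theorem mul_sin_le_mul_cos {x : ℝ} (hx0 : 0 ≤ x) (hx : x ≤ Real.pi / 2) :
    (1 - x ^ 2 / 3 - 11 / 250 * x ^ 4) * Real.sin x ≤ x * Real.cos x := by
  have key : MonotoneOn
      (fun x : ℝ => x * Real.cos x - (1 - x ^ 2 / 3 - 11 / 250 * x ^ 4) * Real.sin x)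
      (Set.Icc 0 (Real.pi / 2)) := by
    apply monotoneOn_of_deriv_nonneg (convex_Icc _ _) (by fun_prop) (by fun_prop)
    intro y hy
    rw [interior_Icc] at hy
    have hd : HasDerivAt
        (fun x : ℝ => x * Real.cos x - (1 - x ^ 2 / 3 - 11 / 250 * x ^ 4) * Real.sin x)
        (y * ((y / 3 + 11 / 250 * y ^ 3) * Real.cos y
          - (1 / 3 - 44 / 250 * y ^ 2) * Real.sin y)) y := by
      have h1 : HasDerivAt (fun x : ℝ => 1 - x ^ 2 / 3 - 11 / 250 * x ^ 4)
          (-(2 * y / 3) - 44 / 250 * y ^ 3) y := by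
        exact ((((hasDerivAt_pow 2 y).div_const 3).const_sub 1).sub
          ((hasDerivAt_pow 4 y).const_mul (11 / 250))).congr_deriv (by norm_num; ring)
      exact (((hasDerivAt_id y).mul (Real.hasDerivAt_cos y)).sub
        (h1.mul (Real.hasDerivAt_sin y))).congr_deriv (by simp only [id]; ring)
    rw [hd.deriv]
    have hc : 0 ≤ Real.cos y := Real.cos_nonneg_of_mem_Icc
      ⟨by linarith [hy.1, Real.pi_pos], hy.2.le⟩
    have hs : 2 / Real.pi * y ≤ Real.sin y := Real.mul_le_sin hy.1.le hy.2.le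
    have hs2 : 7 / 11 * y ≤ Real.sin y := by
      refine le_trans ?_ hs
      have : (7 : ℝ) / 11 ≤ 2 / Real.pi := by
        rw [div_le_div_iff₀ (by norm_num) Real.pi_pos]
        linarith [Real.pi_lt_d4]
      exact mul_le_mul_of_nonneg_right this hy.1.le
    have h3 : Real.sin y - y * Real.cos y ≤ y ^ 3 / 3 := by
      have key : MonotoneOn (fun x : ℝ => x ^ 3 / 3 - (Real.sin x - x * Real.cos x))
          (Set.Icc 0 (Real.pi / 2)) := by
        apply monotoneOn_of_deriv_nonneg (convex_Icc _ _) (by fun_prop) (by fun_prop)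
        intro z hz
        rw [interior_Icc] at hz
        have hd : HasDerivAt (fun x : ℝ => x ^ 3 / 3 - (Real.sin x - x * Real.cos x))
            (z * (z - Real.sin z)) z := by
          exact (((hasDerivAt_pow 3 z).div_const 3).sub ((Real.hasDerivAt_sin z).sub
            ((hasDerivAt_id z).mul (Real.hasDerivAt_cos z)))).congr_deriv (by norm_num; ring)
        rw [hd.deriv]
        exact mul_nonneg hz.1.le (by linarith [Real.sin_le hz.1.le])
      have := key ⟨le_rfl, by linarith [Real.pi_pos]⟩ ⟨hy.1.le, hy.2.le⟩ hy.1.le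
      simp at this
      linarith
    have hy0 := hy.1
    have e1 : (7 / 11 * y) * y ^ 2 ≤ Real.sin y * y ^ 2 :=
      mul_le_mul_of_nonneg_right hs2 (by positivity)
    have e2 : 0 ≤ y ^ 3 * Real.cos y := by positivity
    have e3 : 0 < y ^ 3 := by positivity
    apply mul_nonneg hy0.le
    nlinarith
  have := key ⟨le_rfl, by linarith [Real.pi_pos]⟩ ⟨hx0, hx⟩ hx0
  simp at this
  linarith

theorem cos_div_sin_le {x : ℝ} (hx0 : 0 < x) (hx : x < Real.pi) :
    Real.cos x / Real.sin x ≤ 1 / x - x / 3 := by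
  have hs := Real.sin_pos_of_pos_of_lt_pi hx0 hx
  have h := mul_cos_le_mul_sin hx0.le hx.le
  rw [div_le_iff₀ hs]
  have : (1 / x - x / 3) * Real.sin x = ((1 - x ^ 2 / 3) * Real.sin x) / x := by field_simp
  rw [this, le_div_iff₀ hx0]
  linarith

theorem le_cos_div_sin {x : ℝ} (hx0 : 0 < x) (hx : x ≤ Real.pi / 2) :
    1 / x - x / 3 - 11 / 250 * x ^ 3 ≤ Real.cos x / Real.sin x := by
  have hs := Real.sin_pos_of_pos_of_lt_pi hx0 (by linarith [Real.pi_pos])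
  have h := mul_sin_le_mul_cos hx0.le hx
  rw [le_div_iff₀ hs]
  have : (1 / x - x / 3 - 11 / 250 * x ^ 3) * Real.sin x
      = ((1 - x ^ 2 / 3 - 11 / 250 * x ^ 4) * Real.sin x) / x := by field_simp
  rw [this, div_le_iff₀ hx0]
  linarith

theorem prawitzKernel_one_sub (w : ℝ) : prawitzKernel (1 - w) =
    1 / Real.pi - w * (Real.cos (Real.pi * w) / Real.sin (Real.pi * w)) := by
  unfold prawitzKernel
  rw [show Real.pi * (1 - w) = Real.pi - Real.pi * w by ring, Real.cos_pi_sub, Real.sin_pi_sub]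
  ring

theorem prawitzKernel_le {u : ℝ} (h0 : 0 < u) (h1 : u < 1) :
    prawitzKernel u ≤ 1 / (Real.pi * u) - (1 - u) * (Real.pi * u / 3) := by
  have hp := Real.pi_pos
  have h := cos_div_sin_le (x := Real.pi * u) (by positivity) (by nlinarith)
  have h2 := mul_le_mul_of_nonneg_left h (by linarith : 0 ≤ 1 - u)
  unfold prawitzKernel
  have e : 1 / (Real.pi * u) = (1 - u) * (1 / (Real.pi * u)) + 1 / Real.pi := by
    field_simp; ring
  rw [e]
  linarith

theorem le_prawitzKernel {u : ℝ} (h0 : 0 < u) (h1 : u < 1) :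
    Real.pi * (1 - u) ^ 2 / 3 ≤ prawitzKernel u := by
  have hp := Real.pi_pos
  have hw : 0 < 1 - u := by linarith
  have h := cos_div_sin_le (x := Real.pi * (1 - u)) (by positivity) (by nlinarith)
  have h2 := mul_le_mul_of_nonneg_left h hw.le
  have := prawitzKernel_one_sub (1 - u)
  rw [sub_sub_cancel] at this
  rw [this]
  have e : 1 / Real.pi = (1 - u) * (1 / (Real.pi * (1 - u))) := by field_simp
  nlinarith

theorem prawitzKernel_nonneg {u : ℝ} (h0 : 0 < u) (h1 : u < 1) : 0 ≤ prawitzKernel u :=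
  le_trans (by have := Real.pi_pos; positivity) (le_prawitzKernel h0 h1)

theorem prawitzKernel_sq_le_of_le_half {u : ℝ} (h0 : 0 < u) (h1 : u ≤ 1 / 2) :
    (1 - u) ^ 2 + prawitzKernel u ^ 2 ≤ (33 / 100 / u) ^ 2 := by
  have hp := Real.pi_pos
  have hl := Real.pi_gt_d4
  have hr := Real.pi_lt_d4
  have hc := prawitzKernel_le h0 (by linarith)
  have hc0 := prawitzKernel_nonneg h0 (by linarith : u < 1)
  have hc1 : prawitzKernel u * u ≤ 3184 / 10000 - (1 - u) * u ^ 2 * (1047 / 1000) := by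
    have e1 : 1 / (Real.pi * u) * u ≤ 3184 / 10000 := by
      rw [show 1 / (Real.pi * u) * u = 1 / Real.pi by field_simp, div_le_iff₀ hp]
      linarith
    have e2 : (1 - u) * u ^ 2 * (1047 / 1000) ≤ (1 - u) * (Real.pi * u / 3) * u := by
      have : 0 ≤ (1 - u) * u ^ 2 := mul_nonneg (by linarith) (by positivity)
      nlinarith
    have := mul_le_mul_of_nonneg_right hc h0.le
    linarith
  have hc2 : (prawitzKernel u * u) ^ 2 ≤ (3184 / 10000 - (1 - u) * u ^ 2 * (1047 / 1000)) ^ 2 :=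
    pow_le_pow_left₀ (by positivity) hc1 2
  rw [div_pow, le_div_iff₀ (by positivity)]
  have hpoly : (1 - u) ^ 2 * u ^ 2 + (3184 / 10000 - (1 - u) * u ^ 2 * (1047 / 1000)) ^ 2
      ≤ (33 / 100 : ℝ) ^ 2 := by
    have a : 0 ≤ u * (1 - 2 * u) := mul_nonneg h0.le (by linarith)
    nlinarith [sq_nonneg (u * (u - 3 / 10)), sq_nonneg (u - 3 / 10),
      mul_nonneg a (sq_nonneg (u - 3 / 10)),
      mul_nonneg h0.le (sq_nonneg (u - 3/10)), mul_nonneg a a, mul_nonneg (mul_nonneg a a) h0.le]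
  nlinarith

theorem prawitzKernel_sq_le_of_half_le {u : ℝ} (h0 : 1 / 2 ≤ u) (h1 : u < 1) :
    (1 - u) ^ 2 + prawitzKernel u ^ 2 ≤ ((1 - u) * (1 + (1 - u) ^ 2)) ^ 2 := by
  have hp := Real.pi_pos
  have hr := Real.pi_lt_d4
  have hw : 0 < 1 - u := by linarith
  have hc0 := prawitzKernel_nonneg (by linarith : 0 < u) h1
  have h := le_cos_div_sin (x := Real.pi * (1 - u)) (by positivity) (by nlinarith)
  have h2 := mul_le_mul_of_nonneg_left h hw.le
  have hk := prawitzKernel_one_sub (1 - u)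
  rw [sub_sub_cancel] at hk
  have e : (1 - u) * (1 / (Real.pi * (1 - u))) = 1 / Real.pi := by field_simp
  have hc : prawitzKernel u ≤ 14 / 10 * (1 - u) ^ 2 := by
    rw [hk]
    have hw2 : (1 - u) ^ 2 ≤ 1 / 4 := by nlinarith
    have hp3 : Real.pi ^ 3 ≤ 31.01 := by
      calc Real.pi ^ 3 ≤ 3.1416 ^ 3 := pow_le_pow_left₀ hp.le hr.le 3
        _ ≤ _ := by norm_num
    have : Real.pi ^ 3 * (1 - u) ^ 2 ≤ 31.01 * (1 / 4) :=
      mul_le_mul hp3 hw2 (by positivity) (by norm_num)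
    have h5 : (1 - u) ^ 2 * (Real.pi / 3 + 11 / 250 * (Real.pi ^ 3 * (1 - u) ^ 2))
        ≤ (1 - u) ^ 2 * (14 / 10) := mul_le_mul_of_nonneg_left (by linarith) (by positivity)
    nlinarith
  have := pow_le_pow_left₀ hc0 hc 2
  have : 0 ≤ (1 - u) ^ 4 := by positivity
  have : 0 ≤ (1 - u) ^ 6 := by positivity
  nlinarith

theorem prawitzKernel_sub_sq_le {u : ℝ} (h0 : 0 < u) (h1 : u < 1) :
    (1 - u) ^ 2 + (prawitzKernel u - 1 / (Real.pi * u)) ^ 2 ≤ (1 - u + 55 / 100 * u ^ 2) ^ 2 := by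
  have hp := Real.pi_pos
  have hl := Real.pi_gt_d4
  have hr := Real.pi_lt_d4
  have hw : 0 < 1 - u := by linarith
  have hk : prawitzKernel u ≤ 1 / (Real.pi * u) :=
    (prawitzKernel_le h0 h1).trans (by
      have : 0 ≤ (1 - u) * (Real.pi * u / 3) := by positivity
      linarith)
  rcases le_or_gt u (1 / 2) with h | h
  · have h3 := le_cos_div_sin (x := Real.pi * u) (by positivity) (by nlinarith)
    have h2 := mul_le_mul_of_nonneg_left h3 hw.le
    have e : 1 / (Real.pi * u) = (1 - u) * (1 / (Real.pi * u)) + 1 / Real.pi := by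
      field_simp; ring
    have hp3 : Real.pi ^ 3 ≤ 31.01 := by
      calc Real.pi ^ 3 ≤ 3.1416 ^ 3 := pow_le_pow_left₀ hp.le hr.le 3
        _ ≤ _ := by norm_num
    have hc : 1 / (Real.pi * u) - prawitzKernel u
        ≤ u * ((1 - u) * (10473 / 10000 + 1365 / 1000 * u ^ 2)) := by
      have h5 : (1 - u) * u * (Real.pi / 3 + 11 / 250 * Real.pi ^ 3 * u ^ 2)
          ≤ (1 - u) * u * (10473 / 10000 + 1365 / 1000 * u ^ 2) := by
        apply mul_le_mul_of_nonneg_left _ (by positivity)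
        have := mul_le_mul_of_nonneg_right hp3 (sq_nonneg u)
        nlinarith
      unfold prawitzKernel
      nlinarith
    have hsq := pow_le_pow_left₀ (by linarith) hc 2
    have hpoly : ((1 - u) * (10473 / 10000 + 1365 / 1000 * u ^ 2)) ^ 2
        ≤ 11 / 10 * (1 - u) + (55 / 100) ^ 2 * u ^ 2 := by
      have hE : (1 - u) * (10473 / 10000 + 1365 / 1000 * u ^ 2) ≤ 10473 / 10000 * (1 - u/2) := by
        nlinarith [mul_nonneg h0.le (sq_nonneg (u - 1/2))]
      have := pow_le_pow_left₀ (by positivity) hE 2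
      nlinarith
    have := mul_le_mul_of_nonneg_left hpoly (sq_nonneg u)
    nlinarith
  · have hc := le_prawitzKernel h0 h1
    have e1 : 1 / (Real.pi * u) ≤ 3184 / 10000 / u := by
      rw [div_le_div_iff₀ (by positivity) h0]
      nlinarith
    have e2 : 3184 / 10000 / u ≤ 3184 / 10000 * (3 - 2 * u) := by
      rw [div_le_iff₀ h0]
      nlinarith
    have hd : 1 / (Real.pi * u) - prawitzKernel u
        ≤ 3184 / 10000 * (3 - 2 * u) - 1047 / 1000 * (1 - u) ^ 2 := by
      have : 1047 / 1000 * (1 - u) ^ 2 ≤ Real.pi * (1 - u) ^ 2 / 3 := by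
        nlinarith [sq_nonneg (1 - u)]
      linarith
    have hsq := pow_le_pow_left₀ (by linarith) hd 2
    have hpoly : (1 - u) ^ 2 + (3184 / 10000 * (3 - 2 * u) - 1047 / 1000 * (1 - u) ^ 2) ^ 2
        ≤ (1 - u + 55 / 100 * u ^ 2) ^ 2 := by
      have hu : 0 ≤ u - 1 / 2 := by linarith
      nlinarith [mul_nonneg hu hw.le, mul_nonneg (mul_nonneg hu hw.le) hw.le,
        mul_nonneg (mul_nonneg hu hw.le) h0.le]
    nlinarith

theorem norm_exp_mul_I_sub_one_sub_le {x : ℝ} (hx : 0 ≤ x) :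
    ‖Complex.exp (x * Complex.I) - 1 - x * Complex.I‖ ≤ x ^ 2 / 2 := by
  have hd (y : ℝ) : HasDerivAt (fun x : ℝ => Complex.exp (x * Complex.I) - 1 - x * Complex.I)
      ((Complex.exp (y * Complex.I) - 1) * Complex.I) y := by
    have h1 : HasDerivAt (fun x : ℝ => (x : ℂ) * Complex.I) Complex.I y :=
      ((Complex.ofRealCLM.hasDerivAt (x := y)).mul_const Complex.I).congr_deriv (by simp)
    exact ((h1.cexp.sub_const 1).sub h1).congr_deriv (by ring)
  refine image_norm_le_of_norm_deriv_right_le_deriv_boundary (a := 0) (b := x)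
    (B := fun x => x ^ 2 / 2) (B' := fun x => x)
    (fun y _ => (hd y).continuousAt.continuousWithinAt)
    (fun y _ => (hd y).hasDerivWithinAt) (by simp)
    (fun y => ((hasDerivAt_pow 2 y).div_const 2).congr_deriv (by norm_num)) ?_ ⟨hx, le_rfl⟩
  intro y hy
  rw [norm_mul, Complex.norm_I, mul_one, mul_comm]
  refine (Real.norm_exp_I_mul_ofReal_sub_one_le).trans ?_
  rw [Real.norm_eq_abs, abs_of_nonneg hy.1]

theorem norm_exp_mul_I_sub_quadratic_le (x : ℝ) :
    ‖Complex.exp (x * Complex.I) - (1 + x * Complex.I - x ^ 2 / 2)‖ ≤ |x| ^ 3 / 6 := by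
  have main {x : ℝ} (hx : 0 ≤ x) :
      ‖Complex.exp (x * Complex.I) - (1 + x * Complex.I - x ^ 2 / 2)‖ ≤ x ^ 3 / 6 := by
    have hd (y : ℝ) : HasDerivAt
        (fun x : ℝ => Complex.exp (x * Complex.I) - (1 + x * Complex.I - (x : ℂ) ^ 2 / 2))
        ((Complex.exp (y * Complex.I) - 1 - y * Complex.I) * Complex.I) y := by
      have h0 : HasDerivAt (fun x : ℝ => (x : ℂ)) 1 y := Complex.ofRealCLM.hasDerivAt (x := y)
      have h1 : HasDerivAt (fun x : ℝ => (x : ℂ) * Complex.I) Complex.I y :=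
        (h0.mul_const Complex.I).congr_deriv (by simp)
      refine (h1.cexp.sub ((h1.const_add 1).sub ((h0.pow 2).div_const 2))).congr_deriv ?_
      have := Complex.I_mul_I
      push_cast
      linear_combination (y : ℂ) * Complex.I_mul_I
    refine image_norm_le_of_norm_deriv_right_le_deriv_boundary (a := 0) (b := x)
      (B := fun x => x ^ 3 / 6) (B' := fun x => x ^ 2 / 2)
      (fun y _ => (hd y).continuousAt.continuousWithinAt)
      (fun y _ => (hd y).hasDerivWithinAt) (by simp)
      (fun y => ((hasDerivAt_pow 3 y).div_const 6).congr_deriv (by norm_num; ring)) ?_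
      ⟨hx, le_rfl⟩
    intro y hy
    rw [norm_mul, Complex.norm_I, mul_one]
    exact norm_exp_mul_I_sub_one_sub_le hy.1
  rcases le_total 0 x with h | h
  · rw [abs_of_nonneg h]; exact main h
  · have := main (neg_nonneg.2 h)
    rw [abs_of_nonpos h, ← Complex.norm_conj]
    refine le_of_eq_of_le ?_ this
    congr 1
    have h2 : (starRingEnd ℂ) 2 = 2 := Complex.conj_ofNat 2
    rw [map_sub, ← Complex.exp_conj]
    simp [h2]

theorem abs_exp_neg_sub_one_sub_le {x : ℝ} (hx : 0 ≤ x) :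
    |Real.exp (-x) - (1 - x)| ≤ x ^ 2 / 2 := by
  have h1 := Real.add_one_le_exp (-x)
  rw [abs_of_nonneg (by linarith)]
  have h2 := Real.quadratic_le_exp_of_nonneg hx
  have h3 : Real.exp (-x) * Real.exp x = 1 := by rw [← Real.exp_add]; simp
  have h4 := Real.exp_pos (-x)
  have h5 : Real.exp (-x) * (1 + x + x ^ 2 / 2) ≤ 1 := by nlinarith
  have h6 : 1 ≤ (1 - x + x ^ 2 / 2) * (1 + x + x ^ 2 / 2) := by nlinarith [sq_nonneg (x ^ 2)]
  have : Real.exp (-x) ≤ 1 - x + x ^ 2 / 2 :=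
    le_of_mul_le_mul_right (h5.trans h6) (by positivity)
  linarith

theorem cos_le_one_sub_sq_add_cube (x : ℝ) :
    Real.cos x ≤ 1 - x ^ 2 / 2 + |x| ^ 3 / 10 := by
  wlog hx : 0 ≤ x
  · have := this (-x) (by linarith)
    simpa using this
  rw [abs_of_nonneg hx]
  have hl := Real.pi_gt_d4
  have hr := Real.pi_lt_d4
  rcases le_or_gt x (12 / 5) with h | h
  · have h1 : Real.cos x ≤ 1 - x ^ 2 / 2 + x ^ 4 / 24 := by
      have hs := Real.sin_ge_sub_cube (by positivity : 0 ≤ x / 2)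
      have h0 : 0 ≤ x / 2 - (x / 2) ^ 3 / 6 := by
        nlinarith [mul_nonneg hx (by nlinarith : 0 ≤ 24 - x ^ 2)]
      have h2 := pow_le_pow_left₀ h0 hs 2
      have h3 := Real.cos_sq' (x / 2)
      have h4 := Real.cos_two_mul (x / 2)
      rw [mul_div_cancel₀ x two_ne_zero] at h4
      nlinarith [pow_nonneg hx 6]
    nlinarith [mul_nonneg (pow_nonneg hx 3) (by linarith : 0 ≤ 12 / 5 - x)]
  rcases le_or_gt 5 x with h5 | h5
  · have := Real.cos_le_one x
    nlinarith [sq_nonneg x]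
  · have h1 := Real.one_sub_sq_div_two_le_cos (x := x - Real.pi)
    rw [Real.cos_sub_pi] at h1
    have h2 : Real.cos x ≤ -1 + (x - Real.pi) ^ 2 / 2 := by linarith
    have h3 : (x - Real.pi) ^ 2 ≤ (x - 3.1416) ^ 2 + 4 / 10000 := by nlinarith
    have h4 : 0 ≤ (x - 4.13) ^ 2 * (x + 3) := by positivity
    nlinarith

/-- Characteristic function of the law giving mass `p ω` to `a ω`. -/
noncomputable def finCharFun {Ω : Type*} [Fintype Ω] (p a : Ω → ℝ) (s : ℝ) : ℂ :=
  ∑ ω, (p ω : ℂ) * Complex.exp ((s * a ω : ℝ) * Complex.I)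

section FinCharFun

variable {Ω : Type*} [Fintype Ω] {p a : Ω → ℝ}

theorem sum_mul_abs_le_one (hp : ∀ ω, 0 ≤ p ω) (h1 : ∑ ω, p ω = 1)
    (h2 : ∑ ω, p ω * a ω ^ 2 = 1) : ∑ ω, p ω * |a ω| ≤ 1 := by
  have : ∑ ω, p ω * |a ω| ≤ ∑ ω, (p ω / 2 + p ω * a ω ^ 2 / 2) := by
    refine Finset.sum_le_sum fun ω _ => ?_
    have := mul_nonneg (hp ω) (sq_nonneg (|a ω| - 1))
    rw [← sq_abs (a ω)]
    linarith
  rw [Finset.sum_add_distrib, ← Finset.sum_div, ← Finset.sum_div, h1, h2] at this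
  linarith

theorem one_le_sum_mul_abs_cube (hp : ∀ ω, 0 ≤ p ω) (h1 : ∑ ω, p ω = 1)
    (h2 : ∑ ω, p ω * a ω ^ 2 = 1) : 1 ≤ ∑ ω, p ω * |a ω| ^ 3 := by
  have : ∑ ω, (3 * (p ω * a ω ^ 2) / 2 - p ω / 2) ≤ ∑ ω, p ω * |a ω| ^ 3 := by
    refine Finset.sum_le_sum fun ω _ => ?_
    have h := mul_nonneg (hp ω) (mul_nonneg (sq_nonneg (|a ω| - 1))
      (by positivity : 0 ≤ 2 * |a ω| + 1))
    rw [← sq_abs (a ω)]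
    nlinarith
  rw [Finset.sum_sub_distrib, ← Finset.sum_div, ← Finset.sum_div, ← Finset.mul_sum, h1, h2] at this
  linarith

theorem norm_finCharFun_sub_le (hp : ∀ ω, 0 ≤ p ω) (h1 : ∑ ω, p ω = 1) (h0 : ∑ ω, p ω * a ω = 0)
    (h2 : ∑ ω, p ω * a ω ^ 2 = 1) {s : ℝ} (hs : 0 ≤ s) :
    ‖finCharFun p a s - (Real.exp (-(s ^ 2 / 2)) : ℝ)‖
      ≤ (∑ ω, p ω * |a ω| ^ 3) * s ^ 3 / 6 + s ^ 4 / 8 := by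
  have e : ∑ ω, (p ω : ℂ) * (1 + (s * a ω : ℝ) * Complex.I - ((s * a ω : ℝ) : ℂ) ^ 2 / 2)
      = ((1 - s ^ 2 / 2 : ℝ) : ℂ) := by
    have h1' : ∑ ω, (p ω : ℂ) = 1 := by exact_mod_cast h1
    have h0' : ∑ ω, (p ω : ℂ) * a ω = 0 := by exact_mod_cast h0
    have h2' : ∑ ω, (p ω : ℂ) * (a ω : ℂ) ^ 2 = 1 := by exact_mod_cast h2
    calc _ = ∑ ω, ((p ω : ℂ) + (p ω : ℂ) * a ω * (s * Complex.I)
          - (p ω : ℂ) * (a ω : ℂ) ^ 2 * (s ^ 2 / 2)) := by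
            refine Finset.sum_congr rfl fun ω _ => ?_
            push_cast; ring
      _ = _ := by
        rw [Finset.sum_sub_distrib, Finset.sum_add_distrib, ← Finset.sum_mul, ← Finset.sum_mul,
          h1', h0', h2']
        push_cast; ring
  have hA : ‖finCharFun p a s - ((1 - s ^ 2 / 2 : ℝ) : ℂ)‖
      ≤ (∑ ω, p ω * |a ω| ^ 3) * s ^ 3 / 6 := by
    rw [← e, finCharFun, ← Finset.sum_sub_distrib, Finset.sum_mul, Finset.sum_div]
    refine norm_sum_le_of_le _ fun ω _ => ?_
    rw [← mul_sub, norm_mul, Complex.norm_real, Real.norm_eq_abs, abs_of_nonneg (hp ω)]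
    have := mul_le_mul_of_nonneg_left (norm_exp_mul_I_sub_quadratic_le (s * a ω)) (hp ω)
    rw [abs_mul, abs_of_nonneg hs] at this
    refine this.trans (le_of_eq (by ring))
  have hB : ‖((1 - s ^ 2 / 2 : ℝ) : ℂ) - (Real.exp (-(s ^ 2 / 2)) : ℝ)‖ ≤ s ^ 4 / 8 := by
    rw [← Complex.ofReal_sub, Complex.norm_real, Real.norm_eq_abs, abs_sub_comm]
    refine (abs_exp_neg_sub_one_sub_le (by positivity)).trans (le_of_eq (by ring))
  exact (norm_sub_le_norm_sub_add_norm_sub _ _ _).trans (add_le_add hA hB)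

theorem norm_finCharFun_le (hp : ∀ ω, 0 ≤ p ω) (h1 : ∑ ω, p ω = 1) (h0 : ∑ ω, p ω * a ω = 0)
    (h2 : ∑ ω, p ω * a ω ^ 2 = 1) {s : ℝ} (hs : 0 ≤ s) :
    ‖finCharFun p a s‖ ≤ Real.exp (-(s ^ 2 / 2 - (∑ ω, p ω * |a ω| ^ 3) * s ^ 3 / 5)) := by
  set β := ∑ ω, p ω * |a ω| ^ 3 with hβ
  have hnormSq : ‖finCharFun p a s‖ ^ 2
      = ∑ ω, ∑ ω', p ω * p ω' * Real.cos (s * (a ω - a ω')) := by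
    have : ((‖finCharFun p a s‖ ^ 2 : ℝ) : ℂ) = ∑ ω, ∑ ω', ((p ω * p ω' : ℝ) : ℂ) *
        Complex.exp ((s * (a ω - a ω') : ℝ) * Complex.I) := by
      rw [Complex.ofReal_pow, ← Complex.mul_conj', finCharFun, map_sum, Finset.sum_mul_sum]
      refine Finset.sum_congr rfl fun ω _ => Finset.sum_congr rfl fun ω' _ => ?_
      rw [map_mul, ← Complex.exp_conj, map_mul, Complex.conj_ofReal, Complex.conj_ofReal,
        Complex.conj_I, mul_mul_mul_comm, ← Complex.exp_add]
      push_cast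
      congr 2
      ring
    have := congrArg Complex.re this
    rw [Complex.ofReal_re] at this
    rw [this, Complex.re_sum]
    refine Finset.sum_congr rfl fun ω _ => ?_
    rw [Complex.re_sum]
    refine Finset.sum_congr rfl fun ω' _ => ?_
    rw [Complex.re_ofReal_mul, Complex.exp_ofReal_mul_I_re]
  have hterm (ω ω' : Ω) : p ω * p ω' * Real.cos (s * (a ω - a ω')) ≤
      p ω * p ω' + (s ^ 2 * ((p ω * a ω) * (p ω' * a ω'))
        - s ^ 2 / 2 * ((p ω * a ω ^ 2) * p ω' + p ω * (p ω' * a ω' ^ 2)))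
      + s ^ 3 / 10 * ((p ω * |a ω| ^ 3) * p ω' + p ω * (p ω' * |a ω'| ^ 3)
        + (p ω * |a ω|) * (p ω' * a ω' ^ 2) + (p ω * a ω ^ 2) * (p ω' * |a ω'|)
        - 2 * ((p ω * (a ω * |a ω|)) * (p ω' * a ω'))
        - 2 * ((p ω * a ω) * (p ω' * (a ω' * |a ω'|)))) := by
    have hc := cos_le_one_sub_sq_add_cube (s * (a ω - a ω'))
    rw [abs_mul, abs_of_nonneg hs] at hc
    have h3 : |a ω - a ω'| ^ 3 ≤ (|a ω| + |a ω'|) * (a ω - a ω') ^ 2 := by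
      rw [pow_succ' _ 2, sq_abs]
      exact mul_le_mul_of_nonneg_right (abs_sub _ _) (sq_nonneg _)
    have hc' : Real.cos (s * (a ω - a ω')) ≤ 1 - s ^ 2 / 2 * (a ω - a ω') ^ 2
        + s ^ 3 / 10 * ((|a ω| + |a ω'|) * (a ω - a ω') ^ 2) := by
      have := mul_le_mul_of_nonneg_left h3 (by positivity : 0 ≤ s ^ 3 / 10)
      nlinarith
    refine (mul_le_mul_of_nonneg_left hc' (mul_nonneg (hp ω) (hp ω'))).trans (le_of_eq ?_)
    have e1 : |a ω| ^ 3 = |a ω| * a ω ^ 2 := by rw [pow_succ' _ 2, sq_abs]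
    have e2 : |a ω'| ^ 3 = |a ω'| * a ω' ^ 2 := by rw [pow_succ' _ 2, sq_abs]
    rw [e1, e2]
    ring
  have hE := sum_mul_abs_le_one hp h1 h2
  have hβ1 := one_le_sum_mul_abs_cube hp h1 h2
  have hsq : ‖finCharFun p a s‖ ^ 2 ≤ 1 - s ^ 2 + 2 / 5 * β * s ^ 3 := by
    rw [hnormSq]
    refine (Finset.sum_le_sum fun ω _ => Finset.sum_le_sum fun ω' _ => hterm ω ω').trans ?_
    simp only [Finset.sum_add_distrib, Finset.sum_sub_distrib, ← Finset.mul_sum, ← Finset.sum_mul,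
      h1, h0, h2, ← hβ]
    have := mul_le_mul_of_nonneg_left hE (by positivity : 0 ≤ s ^ 3)
    have := mul_le_mul_of_nonneg_left hβ1 (by positivity : 0 ≤ s ^ 3)
    nlinarith
  have hexp : ‖finCharFun p a s‖ ^ 2 ≤ Real.exp (-(s ^ 2 / 2 - β * s ^ 3 / 5)) ^ 2 := by
    rw [← Real.exp_nat_mul]
    refine hsq.trans ((le_of_eq ?_).trans (Real.add_one_le_exp _))
    push_cast; ring
  exact (pow_le_pow_iff_left₀ (norm_nonneg _) (Real.exp_pos _).le two_ne_zero).1 hexp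

end FinCharFun

theorem norm_pow_sub_pow_le {z b : ℂ} {A B : ℝ} (hz : ‖z‖ ≤ A) (hb : ‖b‖ ≤ B) (hBA : B ≤ A)
    (n : ℕ) : ‖z ^ n - b ^ n‖ ≤ n * ‖z - b‖ * ((B ^ (n - 1) + A ^ (n - 1)) / 2) := by
  have hB : 0 ≤ B := (norm_nonneg _).trans hb
  have hA : 0 ≤ A := hB.trans hBA
  have hsum : 2 * ∑ i ∈ Finset.range n, A ^ i * B ^ (n - 1 - i)
      ≤ n * (B ^ (n - 1) + A ^ (n - 1)) := by
    have hr := Finset.sum_range_reflect (fun i => A ^ i * B ^ (n - 1 - i)) n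
    rw [two_mul]
    nth_rewrite 1 [← hr]
    rw [← Finset.sum_add_distrib]
    refine (Finset.sum_le_card_nsmul _ _ (B ^ (n - 1) + A ^ (n - 1)) fun i hi => ?_).trans ?_
    · have hi' : i ≤ n - 1 := by have := Finset.mem_range.1 hi; omega
      have h1 := pow_le_pow_left₀ hB hBA i
      have h2 := pow_le_pow_left₀ hB hBA (n - 1 - i)
      have e : n - 1 - (n - 1 - i) = i := by omega
      have eA : A ^ (n - 1) = A ^ i * A ^ (n - 1 - i) := by rw [← pow_add]; congr 1; omega
      have eB : B ^ (n - 1) = B ^ i * B ^ (n - 1 - i) := by rw [← pow_add]; congr 1; omega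
      rw [e, eA, eB]
      nlinarith [mul_nonneg (sub_nonneg.2 h1) (sub_nonneg.2 h2)]
    · simp [mul_add]
  rw [← Commute.geom_sum₂_mul (Commute.all z b), norm_mul]
  have : ‖∑ i ∈ Finset.range n, z ^ i * b ^ (n - 1 - i)‖
      ≤ ∑ i ∈ Finset.range n, A ^ i * B ^ (n - 1 - i) := by
    refine norm_sum_le_of_le _ fun i _ => ?_
    rw [norm_mul, norm_pow, norm_pow]
    gcongr
  calc _ ≤ (n * (B ^ (n - 1) + A ^ (n - 1)) / 2) * ‖z - b‖ := by
        refine mul_le_mul_of_nonneg_right ?_ (norm_nonneg _)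
        linarith
    _ = _ := by ring

theorem norm_finCharFun_pow_sub_le {Ω : Type*} [Fintype Ω] {p a : Ω → ℝ} (hp : ∀ ω, 0 ≤ p ω)
    (h1 : ∑ ω, p ω = 1) (h0 : ∑ ω, p ω * a ω = 0) (h2 : ∑ ω, p ω * a ω ^ 2 = 1)
    {n : ℕ} (hn : 0 < n) {L : ℝ} (hL : L = (∑ ω, p ω * |a ω| ^ 3) / Real.sqrt n)
    {z : ℝ} (hz : 0 ≤ z) (hz' : z ≤ 5 / 2) :
    ‖finCharFun p a (z / (L * Real.sqrt n)) ^ n - (Real.exp (-((z / L) ^ 2 / 2)) : ℝ)‖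
      ≤ (z ^ 3 / 6 + z ^ 4 / 8) / L ^ 2 * ((Real.exp (-((1 / L ^ 2 - 1) * (z ^ 2 / 2)))
        + Real.exp (-((1 / L ^ 2 - 1) * (z ^ 2 / 2 - z ^ 3 / 5)))) / 2) := by
  have hβ1 := one_le_sum_mul_abs_cube hp h1 h2
  set β := ∑ ω, p ω * |a ω| ^ 3 with hβ
  have hr : 0 < Real.sqrt n := Real.sqrt_pos.2 (by exact_mod_cast hn)
  have hrn : Real.sqrt n ^ 2 = n := Real.sq_sqrt (by positivity)
  set r := Real.sqrt n with hr_def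
  have hβp : 0 < β := by linarith
  have hβL : β = L * r := by rw [hL]; field_simp
  have hLp : 0 < L := by rw [hL]; positivity
  set s := z / (L * r) with hs_def
  have hs : 0 ≤ s := by positivity
  have e1 := norm_finCharFun_sub_le hp h1 h0 h2 hs
  have e2 := norm_finCharFun_le hp h1 h0 h2 hs
  rw [← hβ] at e1 e2
  have hpow := norm_pow_sub_pow_le (b := (Real.exp (-(s ^ 2 / 2)) : ℝ)) e2
    (by rw [Complex.norm_real, Real.norm_eq_abs, abs_of_pos (Real.exp_pos _)])
    (Real.exp_le_exp.2 (by
      have : 0 ≤ β * s ^ 3 / 5 := by positivity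
      linarith)) n
  have hn1 : (((n - 1 : ℕ)) : ℝ) = r ^ 2 - 1 := by rw [hrn, Nat.cast_sub hn]; simp
  have hb : ((Real.exp (-(s ^ 2 / 2)) : ℝ) : ℂ) ^ n = (Real.exp (-((z / L) ^ 2 / 2)) : ℝ) := by
    rw [← Complex.ofReal_pow, ← Real.exp_nat_mul, ← hrn, hs_def]
    congr 3
    field_simp
  rw [hb] at hpow
  refine hpow.trans (mul_le_mul ?_ ?_ (by positivity) (by positivity))
  · refine (mul_le_mul_of_nonneg_left e1 (by positivity)).trans ?_
    rw [hβL, ← hrn, hs_def]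
    have hrL : 1 ≤ L * r := by rw [← hβL]; exact hβ1
    have : r ^ 2 * (L * r * (z / (L * r)) ^ 3 / 6 + (z / (L * r)) ^ 4 / 8)
        = z ^ 3 / 6 / L ^ 2 + z ^ 4 / 8 / L ^ 2 * (1 / (L * r) ^ 2) := by
      field_simp
    rw [this, add_div]
    have h3 : 1 / (L * r) ^ 2 ≤ 1 := by
      rw [div_le_one (by positivity)]
      exact one_le_pow₀ hrL
    have := mul_le_mul_of_nonneg_left h3 (by positivity : 0 ≤ z ^ 4 / 8 / L ^ 2)
    linarith
  · have key {w : ℝ} (hw : 0 ≤ w) {q : ℝ} (hq : q = w / (L * r) ^ 2) :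
        Real.exp (-q) ^ (n - 1) ≤ Real.exp (-((1 / L ^ 2 - 1) * w)) := by
      rw [← Real.exp_nat_mul, hn1, hq]
      refine Real.exp_le_exp.2 ?_
      have hrL : 1 ≤ (L * r) ^ 2 := by rw [← hβL]; exact one_le_pow₀ hβ1
      have : (r ^ 2 - 1) * -(w / (L * r) ^ 2) = -(1 / L ^ 2 * w) + w / (L * r) ^ 2 := by
        field_simp
        ring
      rw [this]
      have : w / (L * r) ^ 2 ≤ w := div_le_self hw hrL
      linarith
    have k1 := key (w := z ^ 2 / 2) (by positivity) (q := s ^ 2 / 2)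
      (by rw [hs_def]; field_simp)
    have k2 := key (w := z ^ 2 / 2 - z ^ 3 / 5)
      (by nlinarith [mul_nonneg (sq_nonneg z) (sub_nonneg.2 hz')])
      (q := s ^ 2 / 2 - β * s ^ 3 / 5) (by rw [hs_def, hβL]; field_simp)
    linarith

/-- Integrand of the Prawitz minorant of the unit step function. -/
noncomputable def prawitzIntegrand (y u : ℝ) : ℝ :=
  prawitzKernel u * Real.sin (2 * Real.pi * u * y)
    - (1 - u) * Real.cos (2 * Real.pi * u * y)

/-- The Prawitz band-limited minorant of the unit step function. -/
noncomputable def prawitzMinorant (y : ℝ) : ℝ :=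
  1 / 2 + ∫ u in (0 : ℝ)..1, prawitzIntegrand y u

theorem measurable_prawitzKernel : Measurable prawitzKernel := by
  unfold prawitzKernel
  fun_prop

theorem prawitzKernel_mul_le {u : ℝ} (h0 : 0 < u) (h1 : u < 1) :
    prawitzKernel u * u ≤ 1 / Real.pi := by
  have hp := Real.pi_pos
  have h := prawitzKernel_le h0 h1
  have : 0 ≤ (1 - u) * (Real.pi * u / 3) := mul_nonneg (by linarith) (by positivity)
  calc prawitzKernel u * u ≤ 1 / (Real.pi * u) * u :=
        mul_le_mul_of_nonneg_right (by linarith) h0.le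
    _ = 1 / Real.pi := by field_simp

theorem intervalIntegrable_of_measurable_of_norm_le {E : Type*} [NormedAddCommGroup E]
    {f : ℝ → E} {a b C : ℝ} (hab : a ≤ b)
    (hf : MeasureTheory.AEStronglyMeasurable f MeasureTheory.volume)
    (h : ∀ u, a < u → u < b → ‖f u‖ ≤ C) : IntervalIntegrable f MeasureTheory.volume a b := by
  rw [intervalIntegrable_iff_integrableOn_Ioo_of_le hab]
  refine MeasureTheory.Measure.integrableOn_of_bounded (M := C) (by simp) hf ?_
  rw [MeasureTheory.ae_restrict_iff' measurableSet_Ioo]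
  exact Filter.Eventually.of_forall fun u hu => h u hu.1 hu.2

theorem intervalIntegrable_prawitzIntegrand (y : ℝ) :
    IntervalIntegrable (prawitzIntegrand y) MeasureTheory.volume 0 1 := by
  refine intervalIntegrable_of_measurable_of_norm_le (C := 2 * |y| + 1) zero_le_one ?_ ?_
  · have := measurable_prawitzKernel
    unfold prawitzIntegrand
    exact Measurable.aestronglyMeasurable (by fun_prop)
  · intro u h0 h1
    have hp := Real.pi_pos
    have hc := prawitzKernel_nonneg h0 h1
    have e1 : |Real.sin (2 * Real.pi * u * y)| ≤ 2 * Real.pi * u * |y| := by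
      refine Real.abs_sin_le_abs.trans (le_of_eq ?_)
      rw [abs_mul, abs_of_nonneg (by positivity)]
    have e2 : prawitzKernel u * |Real.sin (2 * Real.pi * u * y)| ≤ 2 * |y| := by
      calc _ ≤ prawitzKernel u * (2 * Real.pi * u * |y|) := mul_le_mul_of_nonneg_left e1 hc
        _ = (prawitzKernel u * u) * (2 * Real.pi * |y|) := by ring
        _ ≤ 1 / Real.pi * (2 * Real.pi * |y|) :=
            mul_le_mul_of_nonneg_right (prawitzKernel_mul_le h0 h1) (by positivity)
        _ = 2 * |y| := by field_simp
    have e3 : (1 - u) * |Real.cos (2 * Real.pi * u * y)| ≤ 1 := by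
      nlinarith [Real.abs_cos_le_one (2 * Real.pi * u * y),
        abs_nonneg (Real.cos (2 * Real.pi * u * y))]
    unfold prawitzIntegrand
    rw [Real.norm_eq_abs]
    refine (abs_sub _ _).trans ?_
    rw [abs_mul, abs_mul, abs_of_nonneg hc, abs_of_nonneg (by linarith : 0 ≤ 1 - u)]
    linarith

theorem prawitzIntegrand_add_one_sub {u : ℝ} (h0 : 0 < u) (h1 : u < 1) (y : ℝ) :
    prawitzIntegrand (y + 1) u - prawitzIntegrand y u =
      2 * (1 - u) * Real.cos (2 * Real.pi * y * u)
        + 1 / Real.pi * (Real.sin (2 * Real.pi * (y + 1) * u) - Real.sin (2 * Real.pi * y * u)) := by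
  have hp := Real.pi_pos
  have hs := Real.sin_pos_of_pos_of_lt_pi (x := Real.pi * u) (by positivity) (by nlinarith)
  have hc : prawitzKernel u * Real.sin (Real.pi * u)
      = (1 - u) * Real.cos (Real.pi * u) + 1 / Real.pi * Real.sin (Real.pi * u) := by
    unfold prawitzKernel
    rw [add_mul, mul_assoc, div_mul_cancel₀ _ hs.ne']
  unfold prawitzIntegrand
  set A := Real.pi * u * (2 * y + 1) with hA
  have a1 : 2 * Real.pi * u * (y + 1) = A + Real.pi * u := by rw [hA]; ring
  have a2 : 2 * Real.pi * u * y = A - Real.pi * u := by rw [hA]; ring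
  rw [show 2 * Real.pi * y * u = A - Real.pi * u by rw [hA]; ring,
    show 2 * Real.pi * (y + 1) * u = A + Real.pi * u by rw [hA]; ring, a1, a2,
    Real.sin_add, Real.sin_sub, Real.cos_add, Real.cos_sub]
  linear_combination 2 * Real.cos A * hc

theorem prawitzMinorant_add_one_sub (y : ℝ) :
    prawitzMinorant (y + 1) - prawitzMinorant y = ∫ u in (0 : ℝ)..1,
      (2 * (1 - u) * Real.cos (2 * Real.pi * y * u)
        + 1 / Real.pi
          * (Real.sin (2 * Real.pi * (y + 1) * u) - Real.sin (2 * Real.pi * y * u))) := by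
  unfold prawitzMinorant
  rw [add_sub_add_left_eq_sub, ← intervalIntegral.integral_sub
    (intervalIntegrable_prawitzIntegrand _) (intervalIntegrable_prawitzIntegrand _)]
  exact intervalIntegral.integral_congr_Ioo_of_le zero_le_one fun u hu =>
    prawitzIntegrand_add_one_sub hu.1 hu.2 y

theorem integral_one_sub_mul_cos {a : ℝ} (ha : a ≠ 0) :
    ∫ u in (0 : ℝ)..1, 2 * (1 - u) * Real.cos (a * u) = 2 * (1 - Real.cos a) / a ^ 2 := by
  have hd (u : ℝ) (_ : u ∈ Set.uIcc (0 : ℝ) 1) : HasDerivAt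
      (fun u : ℝ => 2 * ((1 - u) * Real.sin (a * u) / a - Real.cos (a * u) / a ^ 2))
      (2 * (1 - u) * Real.cos (a * u)) u := by
    have h1 : HasDerivAt (fun u : ℝ => a * u) a u :=
      ((hasDerivAt_id u).const_mul a).congr_deriv (by simp)
    have h2 : HasDerivAt (fun u : ℝ => 1 - u) (-1) u := (hasDerivAt_id u).const_sub 1
    refine ((((h2.mul h1.sin).div_const a).sub (h1.cos.div_const (a ^ 2))).const_mul 2).congr_deriv
      ?_
    field_simp
    ring
  rw [intervalIntegral.integral_eq_sub_of_hasDerivAt hd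
    (Continuous.intervalIntegrable (by fun_prop) _ _)]
  simp
  field_simp
  ring

theorem integral_sin_mul {a : ℝ} (ha : a ≠ 0) :
    ∫ u in (0 : ℝ)..1, Real.sin (a * u) = (1 - Real.cos a) / a := by
  have hd (u : ℝ) (_ : u ∈ Set.uIcc (0 : ℝ) 1) : HasDerivAt
      (fun u : ℝ => -Real.cos (a * u) / a) (Real.sin (a * u)) u := by
    have h1 : HasDerivAt (fun u : ℝ => a * u) a u :=
      ((hasDerivAt_id u).const_mul a).congr_deriv (by simp)
    refine (h1.cos.neg.div_const a).congr_deriv ?_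
    field_simp
  rw [intervalIntegral.integral_eq_sub_of_hasDerivAt hd
    (Continuous.intervalIntegrable (by fun_prop) _ _)]
  simp
  field_simp
  ring

theorem prawitzMinorant_add_one_sub_eq_add (y : ℝ) :
    prawitzMinorant (y + 1) - prawitzMinorant y =
      (∫ u in (0 : ℝ)..1, 2 * (1 - u) * Real.cos (2 * Real.pi * y * u))
        + 1 / Real.pi * ((∫ u in (0 : ℝ)..1, Real.sin (2 * Real.pi * (y + 1) * u))
          - ∫ u in (0 : ℝ)..1, Real.sin (2 * Real.pi * y * u)) := by
  rw [prawitzMinorant_add_one_sub, intervalIntegral.integral_add,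
    intervalIntegral.integral_const_mul, intervalIntegral.integral_sub]
  all_goals exact Continuous.intervalIntegrable (by fun_prop) _ _

theorem prawitzMinorant_add_one_sub_eq {y : ℝ} (h0 : y ≠ 0) (h1 : y + 1 ≠ 0) :
    prawitzMinorant (y + 1) - prawitzMinorant y
      = (1 - Real.cos (2 * Real.pi * y)) / (2 * Real.pi ^ 2 * y ^ 2 * (y + 1)) := by
  have hp := Real.pi_pos
  rw [prawitzMinorant_add_one_sub_eq_add, integral_one_sub_mul_cos (by positivity),
    integral_sin_mul (by positivity), integral_sin_mul (by positivity),
    show 2 * Real.pi * (y + 1) = 2 * Real.pi * y + 2 * Real.pi by ring, Real.cos_add_two_pi]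
  rw [show 2 * Real.pi * y + 2 * Real.pi = 2 * Real.pi * (y + 1) by ring]
  field_simp
  ring

theorem prawitzMinorant_zero : prawitzMinorant 0 = 0 := by
  unfold prawitzMinorant prawitzIntegrand
  simp
  norm_num

theorem prawitzMinorant_natCast_add_one (N : ℕ) : prawitzMinorant (N + 1) = 1 := by
  have hp := Real.pi_pos
  induction N with
  | zero =>
    have h := prawitzMinorant_add_one_sub_eq_add 0
    rw [prawitzMinorant_zero, integral_sin_mul (by simp [hp.ne'])] at h
    have h2 : ∫ u in (0 : ℝ)..1, (1 - u) = 1 / 2 := by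
      rw [intervalIntegral.integral_sub (by simp) (by simp)]
      simp
      norm_num
    simp [h2] at h ⊢
    exact h
  | succ N ih =>
    have h := prawitzMinorant_add_one_sub_eq (y := N + 1) (by positivity) (by positivity)
    have : Real.cos (2 * Real.pi * (N + 1)) = 1 := by
      rw [mul_comm]
      exact_mod_cast Real.cos_nat_mul_two_pi (N + 1)
    rw [this, ih] at h
    push_cast
    simpa [sub_eq_zero] using h

theorem prawitzMinorant_neg_natCast (N : ℕ) : prawitzMinorant (-N) = 0 := by
  have hp := Real.pi_pos
  induction N with
  | zero => simpa using prawitzMinorant_zero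
  | succ N ih =>
    rcases N.eq_zero_or_pos with rfl | hN
    · have h := prawitzMinorant_add_one_sub_eq_add (-1)
      rw [integral_one_sub_mul_cos (by simp [hp.ne']),
        integral_sin_mul (a := 2 * Real.pi * -1) (by simp [hp.ne'])] at h
      simp [prawitzMinorant_zero] at h
      simpa using h
    · have hN' : (0 : ℝ) < N := by exact_mod_cast hN
      have h := prawitzMinorant_add_one_sub_eq (y := -(N + 1)) (by
        have : (0 : ℝ) < N + 1 := by positivity
        exact (neg_neg_of_pos this).ne) (by
        ring_nf; simpa using hN'.ne')
      have hcos : Real.cos (2 * Real.pi * (-(N + 1))) = 1 := by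
        rw [mul_neg, Real.cos_neg, mul_comm]
        exact_mod_cast Real.cos_nat_mul_two_pi (N + 1)
      rw [hcos, show -((N : ℝ) + 1) + 1 = -N by ring, ih] at h
      push_cast
      simp at h
      simpa using h

theorem tendsto_prawitzMinorant_add_sub (y : ℝ) {l : Filter ℕ} {v : ℕ → ℝ}
    (hv : Filter.Tendsto v l (Filter.cocompact ℝ)) :
    Filter.Tendsto (fun N => prawitzMinorant (y + v N) - prawitzMinorant (v N)) l (nhds 0) := by
  have hp := Real.pi_pos
  let h : ℝ → ℂ := fun u => (-(1 - u : ℝ) - (prawitzKernel u : ℝ) * Complex.I)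
    * (Complex.exp (Complex.I * (2 * Real.pi * u * y : ℝ)) - 1)
  have hmeas : Measurable h := by
    have := measurable_prawitzKernel
    fun_prop
  have hbd : ∀ u, 0 < u → u < 1 → ‖h u‖ ≤ 2 * |y| + 2 := by
    intro u h0 h1
    have hc := prawitzKernel_nonneg h0 h1
    have e0 : ‖Complex.exp (Complex.I * (2 * Real.pi * u * y : ℝ)) - 1‖ ≤ 2 := by
      refine (norm_sub_le _ _).trans ?_
      rw [mul_comm, Complex.norm_exp_ofReal_mul_I]
      norm_num
    have e1 : ‖Complex.exp (Complex.I * (2 * Real.pi * u * y : ℝ)) - 1‖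
        ≤ 2 * Real.pi * u * |y| := by
      refine Real.norm_exp_I_mul_ofReal_sub_one_le.trans (le_of_eq ?_)
      rw [Real.norm_eq_abs, abs_mul, abs_of_nonneg (by positivity)]
    have e2 : ‖(-(1 - u : ℝ) - (prawitzKernel u : ℝ) * Complex.I : ℂ)‖
        ≤ 1 + prawitzKernel u := by
      refine (norm_sub_le _ _).trans ?_
      rw [norm_neg, norm_mul, Complex.norm_I, Complex.norm_real, Complex.norm_real, mul_one,
        Real.norm_eq_abs, Real.norm_eq_abs, abs_of_nonneg hc, abs_of_nonneg (by linarith)]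
      linarith
    have e3 : prawitzKernel u * (2 * Real.pi * u * |y|) ≤ 2 * |y| := by
      calc _ = (prawitzKernel u * u) * (2 * Real.pi * |y|) := by ring
        _ ≤ 1 / Real.pi * (2 * Real.pi * |y|) :=
            mul_le_mul_of_nonneg_right (prawitzKernel_mul_le h0 h1) (by positivity)
        _ = 2 * |y| := by field_simp
    have e4 := mul_le_mul_of_nonneg_left e1 hc
    change ‖_ * _‖ ≤ _
    rw [norm_mul]
    refine (mul_le_mul_of_nonneg_right e2 (norm_nonneg _)).trans ?_
    linarith
  have hIntegrable : IntervalIntegrable h MeasureTheory.volume 0 1 :=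
    intervalIntegrable_of_measurable_of_norm_le zero_le_one hmeas.aestronglyMeasurable hbd
  have hRL := (Real.tendsto_integral_exp_smul_cocompact
    (Set.indicator (Set.Ioc (0 : ℝ) 1) h)).comp
    ((Homeomorph.neg ℝ).isClosedEmbedding.tendsto_cocompact.comp hv)
  have hre := (Complex.continuous_re.tendsto 0).comp hRL
  rw [Complex.zero_re] at hre
  refine hre.congr fun N => ?_
  simp only [Function.comp_apply, Homeomorph.coe_neg]
  unfold prawitzMinorant
  rw [add_sub_add_left_eq_sub, ← intervalIntegral.integral_sub
    (intervalIntegrable_prawitzIntegrand _) (intervalIntegrable_prawitzIntegrand _)]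
  have hcongr : ∀ u : ℝ, Real.fourierChar (-(u * -(v N))) • Set.indicator (Set.Ioc (0 : ℝ) 1) h u
      = Set.indicator (Set.Ioc (0 : ℝ) 1)
        (fun u => Complex.exp ((2 * Real.pi * u * v N : ℝ) * Complex.I) * h u) u := by
    intro u
    by_cases hu : u ∈ Set.Ioc (0 : ℝ) 1
    · rw [Set.indicator_of_mem hu, Set.indicator_of_mem hu, Circle.smul_def,
        Real.fourierChar_apply, smul_eq_mul]
      congr 3
      push_cast
      ring
    · rw [Set.indicator_of_notMem hu, Set.indicator_of_notMem hu, smul_zero]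
  simp_rw [hcongr]
  rw [MeasureTheory.integral_indicator measurableSet_Ioc,
    ← intervalIntegral.integral_of_le zero_le_one]
  have hI2 : IntervalIntegrable
      (fun u : ℝ => Complex.exp ((2 * Real.pi * u * v N : ℝ) * Complex.I) * h u)
      MeasureTheory.volume 0 1 := by
    refine intervalIntegrable_of_measurable_of_norm_le (C := 2 * |y| + 2) zero_le_one
      (Measurable.aestronglyMeasurable (by fun_prop)) fun u h0 h1 => ?_
    rw [norm_mul, Complex.norm_exp_ofReal_mul_I, one_mul]
    exact hbd u h0 h1
  have hcomm := Complex.reCLM.intervalIntegral_comp_comm hI2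
  simp only [Complex.reCLM_apply] at hcomm
  rw [← hcomm]
  refine intervalIntegral.integral_congr fun u _ => ?_
  have expand : Complex.exp ((2 * Real.pi * u * v N : ℝ) * Complex.I) * h u =
      (-(1 - u : ℝ) - (prawitzKernel u : ℝ) * Complex.I)
        * (Complex.exp ((2 * Real.pi * u * (y + v N) : ℝ) * Complex.I)
          - Complex.exp ((2 * Real.pi * u * v N : ℝ) * Complex.I)) := by
    have : Complex.exp ((2 * Real.pi * u * (y + v N) : ℝ) * Complex.I) =
        Complex.exp ((2 * Real.pi * u * v N : ℝ) * Complex.I)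
          * Complex.exp (Complex.I * (2 * Real.pi * u * y : ℝ)) := by
      rw [← Complex.exp_add]; congr 1; push_cast; ring
    rw [this]
    ring
  rw [expand]
  simp only [Complex.mul_re, Complex.sub_re, Complex.sub_im, Complex.neg_re, Complex.neg_im,
    Complex.exp_ofReal_mul_I_re, Complex.exp_ofReal_mul_I_im, Complex.ofReal_re,
    Complex.ofReal_im, Complex.mul_im, Complex.I_re, Complex.I_im]
  unfold prawitzIntegrand
  ring

theorem prawitzMinorant_le_one_of_nonneg {y : ℝ} (hy : 0 ≤ y) : prawitzMinorant y ≤ 1 := by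
  rcases hy.eq_or_lt with rfl | hy
  · rw [prawitzMinorant_zero]; exact zero_le_one
  have hmono : Monotone fun N : ℕ => prawitzMinorant (y + N) := by
    refine monotone_nat_of_le_succ fun N => ?_
    have hN : 0 < y + N := by positivity
    have h := prawitzMinorant_add_one_sub_eq (y := y + N) hN.ne' (by positivity)
    have : 0 ≤ (1 - Real.cos (2 * Real.pi * (y + N)))
        / (2 * Real.pi ^ 2 * (y + N) ^ 2 * (y + N + 1)) :=
      div_nonneg (by linarith [Real.cos_le_one (2 * Real.pi * (y + N))]) (by positivity)
    push_cast
    rw [← add_assoc]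
    linarith
  have hlim : Filter.Tendsto (fun N : ℕ => prawitzMinorant (y + N)) Filter.atTop (nhds 1) := by
    have h := tendsto_prawitzMinorant_add_sub y (l := Filter.atTop) (v := fun N => (N : ℝ))
      (tendsto_natCast_atTop_atTop.mono_right (by rw [cocompact_eq_atBot_atTop]; exact le_sup_right))
    have h2 := h.add_const 1
    rw [zero_add] at h2
    refine h2.congr' ?_
    filter_upwards [Filter.eventually_ge_atTop 1] with N hN
    obtain ⟨k, rfl⟩ := Nat.exists_eq_add_of_le' hN
    have := prawitzMinorant_natCast_add_one k
    push_cast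
    rw [this]
    ring
  simpa using hmono.ge_of_tendsto hlim 0

theorem prawitzMinorant_nonpos_of_neg {y : ℝ} (hy : y < 0) : prawitzMinorant y ≤ 0 := by
  have hmono : Monotone fun N : ℕ => prawitzMinorant (y + -N) := by
    refine monotone_nat_of_le_succ fun N => ?_
    have hN : y - N < 0 := by have : (0 : ℝ) ≤ N := by positivity
                              linarith
    have h := prawitzMinorant_add_one_sub_eq (y := y - N - 1) (by linarith) (by linarith)
    have : (1 - Real.cos (2 * Real.pi * (y - N - 1)))
        / (2 * Real.pi ^ 2 * (y - N - 1) ^ 2 * (y - N - 1 + 1)) ≤ 0 := by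
      refine div_nonpos_of_nonneg_of_nonpos
        (by linarith [Real.cos_le_one (2 * Real.pi * (y - N - 1))]) ?_
      exact mul_nonpos_of_nonneg_of_nonpos (by positivity) (by linarith)
    rw [sub_add_cancel] at h this
    push_cast
    rw [show y + -((N : ℝ) + 1) = y - N - 1 by ring, ← sub_eq_add_neg]
    linarith
  have hlim : Filter.Tendsto (fun N : ℕ => prawitzMinorant (y + -N)) Filter.atTop (nhds 0) := by
    have h := tendsto_prawitzMinorant_add_sub y (l := Filter.atTop) (v := fun N => -(N : ℝ))
      ((Filter.tendsto_neg_atTop_atBot.comp tendsto_natCast_atTop_atTop).mono_right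
        (by rw [cocompact_eq_atBot_atTop]; exact le_sup_left))
    refine h.congr fun N => ?_
    rw [prawitzMinorant_neg_natCast, sub_zero]
  simpa using hmono.ge_of_tendsto hlim 0

theorem integral_pow_mul_exp_neg_mul_sq {b : ℝ} (hb : 0 < b) (k : ℕ) :
    ∫ x in Set.Ioi (0 : ℝ), x ^ k * Real.exp (-(b * x ^ 2)) =
      b ^ (-((k : ℝ) + 1) / 2) * (1 / 2) * Real.Gamma (((k : ℝ) + 1) / 2) := by
  rw [← integral_rpow_mul_exp_neg_mul_rpow two_pos
    (by have : (0 : ℝ) ≤ k := by positivity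
        linarith) hb]
  refine MeasureTheory.setIntegral_congr_fun measurableSet_Ioi fun x _ => ?_
  simp

theorem integrableOn_pow_mul_exp_neg_mul_sq {b : ℝ} (hb : 0 < b) (k : ℕ) :
    MeasureTheory.IntegrableOn (fun x : ℝ => x ^ k * Real.exp (-(b * x ^ 2)))
      (Set.Ioi (0 : ℝ)) := by
  have := integrableOn_rpow_mul_exp_neg_mul_sq hb (s := k)
    (by have : (0 : ℝ) ≤ k := by positivity
        linarith)
  simpa using this

theorem integral_exp_neg_mul_sq_Ioi (b : ℝ) :
    ∫ x in Set.Ioi (0 : ℝ), Real.exp (-(b * x ^ 2)) = Real.sqrt (Real.pi / b) / 2 := by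
  simpa using integral_gaussian_Ioi b

theorem integral_mul_exp_neg_mul_sq_Ioi {b : ℝ} (hb : 0 < b) :
    ∫ x in Set.Ioi (0 : ℝ), x * Real.exp (-(b * x ^ 2)) = 1 / (2 * b) := by
  have h := integral_pow_mul_exp_neg_mul_sq hb 1
  norm_num at h
  rw [h, Real.rpow_neg_one]
  field_simp

theorem integral_sq_mul_exp_neg_mul_sq_Ioi {b : ℝ} (hb : 0 < b) :
    ∫ x in Set.Ioi (0 : ℝ), x ^ 2 * Real.exp (-(b * x ^ 2))
      = Real.sqrt (Real.pi / b) / (4 * b) := by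
  have h := integral_pow_mul_exp_neg_mul_sq hb 2
  rw [h]
  have hG : Real.Gamma (((2 : ℕ) + 1 : ℝ) / 2) = Real.sqrt Real.pi / 2 := by
    rw [show ((2 : ℕ) + 1 : ℝ) / 2 = 1 / 2 + 1 by norm_num,
      Real.Gamma_add_one (by norm_num), Real.Gamma_one_half_eq]
    ring
  have hb2 : b ^ (-(((2 : ℕ) : ℝ) + 1) / 2) = 1 / (Real.sqrt b * b) := by
    rw [show -(((2 : ℕ) : ℝ) + 1) / 2 = -(1 / 2 + 1) by norm_num, Real.rpow_neg hb.le,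
      Real.rpow_add hb, Real.rpow_one, ← Real.sqrt_eq_rpow, one_div]
  rw [hG, hb2, Real.sqrt_div Real.pi_pos.le]
  have : 0 < Real.sqrt b := Real.sqrt_pos.2 hb
  field_simp
  norm_num

theorem integral_cube_mul_exp_neg_mul_sq_Ioi {b : ℝ} (hb : 0 < b) :
    ∫ x in Set.Ioi (0 : ℝ), x ^ 3 * Real.exp (-(b * x ^ 2)) = 1 / (2 * b ^ 2) := by
  have h := integral_pow_mul_exp_neg_mul_sq hb 3
  rw [h]
  have hG : Real.Gamma (((3 : ℕ) + 1 : ℝ) / 2) = 1 := by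
    rw [show ((3 : ℕ) + 1 : ℝ) / 2 = 2 by norm_num, Real.Gamma_two]
  have hb2 : b ^ (-(((3 : ℕ) : ℝ) + 1) / 2) = 1 / b ^ 2 := by
    rw [show -(((3 : ℕ) : ℝ) + 1) / 2 = -((2 : ℕ) : ℝ) by norm_num, Real.rpow_neg hb.le,
      Real.rpow_natCast, one_div]
  rw [hG, hb2]
  field_simp

theorem integral_cos_mul_exp_neg_sq (t : ℝ) :
    ∫ v in Set.Ioi (0 : ℝ), Real.cos (t * v) * Real.exp (-(v ^ 2 / 2))
      = Real.sqrt (Real.pi / 2) * Real.exp (-(t ^ 2 / 2)) := by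
  have hF := fourierIntegral_gaussian (b := 1 / 2) (by norm_num) (t : ℂ)
  have hIntegrable : MeasureTheory.Integrable
      (fun x : ℝ => Complex.exp (Complex.I * t * x) * Complex.exp (-(1 / 2) * x ^ 2)) := by
    have := integrable_cexp_quadratic (b := 1 / 2) (by norm_num) (Complex.I * t) 0
    refine this.congr (Filter.Eventually.of_forall fun x => ?_)
    simp only
    rw [← Complex.exp_add]
    congr 1
    ring
  have hre := congrArg Complex.re hF
  rw [← Complex.reCLM_apply, ← Complex.reCLM.integral_comp_comm hIntegrable] at hre
  have e1 : (fun x : ℝ => Complex.reCLM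
      (Complex.exp (Complex.I * t * x) * Complex.exp (-(1 / 2) * x ^ 2)))
      = fun x : ℝ => (fun v => Real.cos (t * v) * Real.exp (-(v ^ 2 / 2))) |x| := by
    funext x
    have h1 : Complex.exp (-(1 / 2) * (x : ℂ) ^ 2) = ((Real.exp (-(x ^ 2 / 2)) : ℝ) : ℂ) := by
      push_cast; congr 1; ring
    have h2 : Complex.I * t * x = ((t * x : ℝ) : ℂ) * Complex.I := by push_cast; ring
    change _ = Real.cos (t * |x|) * Real.exp (-(|x| ^ 2 / 2))
    rw [Complex.reCLM_apply, h1, h2, Complex.re_mul_ofReal, Complex.exp_ofReal_mul_I_re, sq_abs]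
    congr 1
    rcases abs_choice x with h | h
    · rw [h]
    · rw [h, mul_neg, Real.cos_neg]
  rw [e1, integral_comp_abs (f := fun v => Real.cos (t * v) * Real.exp (-(v ^ 2 / 2)))] at hre
  have e2 : (((Real.pi : ℂ) / (1 / 2)) ^ (1 / 2 : ℂ) * Complex.exp (-(t : ℂ) ^ 2 / (4 * (1 / 2)))).re
      = Real.sqrt (2 * Real.pi) * Real.exp (-(t ^ 2 / 2)) := by
    have h1 : ((Real.pi : ℂ) / (1 / 2)) ^ (1 / 2 : ℂ) = ((Real.sqrt (2 * Real.pi) : ℝ) : ℂ) := by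
      rw [Real.sqrt_eq_rpow, Complex.ofReal_cpow (by positivity)]
      push_cast
      congr 1
      ring
    have h2 : Complex.exp (-(t : ℂ) ^ 2 / (4 * (1 / 2)))
        = ((Real.exp (-(t ^ 2 / 2)) : ℝ) : ℂ) := by
      push_cast; congr 1; ring
    rw [h1, h2, ← Complex.ofReal_mul, Complex.ofReal_re]
  rw [e2] at hre
  have e3 : Real.sqrt (2 * Real.pi) = 2 * Real.sqrt (Real.pi / 2) := by
    rw [show 2 * Real.pi = 2 ^ 2 * (Real.pi / 2) by ring, Real.sqrt_mul (by norm_num),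
      Real.sqrt_sq (by norm_num)]
  rw [e3] at hre
  linarith

theorem integral_sin_div_mul_exp_neg_sq (x : ℝ) :
    ∫ v in Set.Ioi (0 : ℝ), Real.sin (x * v) / v * Real.exp (-(v ^ 2 / 2))
      = Real.sqrt (Real.pi / 2) * ∫ t in (0 : ℝ)..x, Real.exp (-(t ^ 2 / 2)) := by
  rw [← intervalIntegral.integral_const_mul]
  simp_rw [← integral_cos_mul_exp_neg_sq]
  rw [MeasureTheory.intervalIntegral_integral_swap]
  · refine MeasureTheory.setIntegral_congr_fun measurableSet_Ioi fun v hv => ?_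
    have hv' : v ≠ 0 := (Set.mem_Ioi.1 hv).ne'
    rw [intervalIntegral.integral_mul_const, intervalIntegral.integral_comp_mul_right _ hv']
    simp
    field_simp
  · have hg : MeasureTheory.Integrable (fun v : ℝ => Real.exp (-(v ^ 2 / 2)))
        (MeasureTheory.volume.restrict (Set.Ioi (0 : ℝ))) := by
      have := integrableOn_pow_mul_exp_neg_mul_sq (b := 1 / 2) (by norm_num) 0
      refine this.congr (Filter.Eventually.of_forall fun v => ?_)
      simp only [pow_zero, one_mul]
      congr 1
      ring
    have h1 : MeasureTheory.Integrable (fun _ : ℝ => (1 : ℝ))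
        (MeasureTheory.volume.restrict (Set.uIoc (0 : ℝ) x)) := by
      rw [MeasureTheory.integrable_const_iff]
      right
      rw [MeasureTheory.isFiniteMeasure_restrict, Set.uIoc]
      simp
    refine (h1.mul_prod hg).mono' (Measurable.aestronglyMeasurable (by fun_prop))
      (Filter.Eventually.of_forall fun z => ?_)
    simp only [Function.uncurry]
    rw [norm_mul, Real.norm_eq_abs, Real.norm_eq_abs, abs_of_pos (Real.exp_pos _)]
    exact mul_le_mul_of_nonneg_right (Real.abs_cos_le_one _) (Real.exp_pos _).le

theorem integrable_exp_neg_sq_div_two :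
    MeasureTheory.Integrable (fun u : ℝ => Real.exp (-u ^ 2 / 2)) := by
  refine (integrable_exp_neg_mul_sq (b := 1 / 2) (by norm_num)).congr
    (Filter.Eventually.of_forall fun v => ?_)
  simp only
  congr 1
  ring

theorem gaussQ_neg_eq (x : ℝ) : gaussQ (-x) = 1 / 2 + ∫ v in Set.Ioi (0 : ℝ),
    Real.sin (x * v) / (Real.pi * v) * Real.exp (-(v ^ 2 / 2)) := by
  have hp := Real.pi_pos
  have h2 : Real.sqrt (2 * Real.pi) = 2 * Real.sqrt (Real.pi / 2) := by
    rw [show 2 * Real.pi = 2 ^ 2 * (Real.pi / 2) by ring, Real.sqrt_mul (by norm_num),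
      Real.sqrt_sq (by norm_num)]
  have hr : 0 < Real.sqrt (Real.pi / 2) := Real.sqrt_pos.2 (by positivity)
  have hrr : Real.sqrt (Real.pi / 2) ^ 2 = Real.pi / 2 := Real.sq_sqrt (by positivity)
  have h0 : ∫ u in Set.Ioi (0 : ℝ), Real.exp (-u ^ 2 / 2) = Real.sqrt (Real.pi / 2) := by
    have := integral_cos_mul_exp_neg_sq 0
    simp only [zero_mul, Real.cos_zero, one_mul] at this
    simp_rw [neg_div]
    rw [this]
    simp
  have hsplit := intervalIntegral.integral_interval_add_Ioi (a := -x) (b := 0)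
    (f := fun u : ℝ => Real.exp (-u ^ 2 / 2)) integrable_exp_neg_sq_div_two.integrableOn
    integrable_exp_neg_sq_div_two.integrableOn
  have hneg : ∫ u in (-x)..0, Real.exp (-u ^ 2 / 2)
      = ∫ t in (0 : ℝ)..x, Real.exp (-(t ^ 2 / 2)) := by
    have := intervalIntegral.integral_comp_neg (a := 0) (b := x)
      (fun u : ℝ => Real.exp (-u ^ 2 / 2))
    rw [neg_zero] at this
    rw [← this]
    simp [neg_div]
  have hJ : ∫ v in Set.Ioi (0 : ℝ), Real.sin (x * v) / (Real.pi * v) * Real.exp (-(v ^ 2 / 2))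
      = 1 / Real.pi * ∫ v in Set.Ioi (0 : ℝ), Real.sin (x * v) / v * Real.exp (-(v ^ 2 / 2)) := by
    rw [← MeasureTheory.integral_const_mul]
    refine MeasureTheory.setIntegral_congr_fun measurableSet_Ioi fun v hv => ?_
    have hv' : v ≠ 0 := (Set.mem_Ioi.1 hv).ne'
    field_simp
  rw [gaussQ, ← hsplit, h0, hneg, hJ, integral_sin_div_mul_exp_neg_sq, h2]
  set J := ∫ t in (0 : ℝ)..x, Real.exp (-(t ^ 2 / 2))
  have : 1 / Real.pi * (Real.sqrt (Real.pi / 2) * J)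
      = (2 * Real.sqrt (Real.pi / 2))⁻¹ * J := by
    have : Real.pi = 2 * Real.sqrt (Real.pi / 2) ^ 2 := by rw [hrr]; ring
    rw [this]
    set r := Real.sqrt (2 * Real.sqrt (Real.pi / 2) ^ 2 / 2) with hrdef
    have hr1 : r = Real.sqrt (Real.pi / 2) := by rw [hrdef, ← this]
    rw [hr1]
    field_simp
  rw [this, mul_add]
  field_simp
  ring

theorem gaussQ_neg_eq_comp_mul (x : ℝ) {T : ℝ} (hT : 0 < T) :
    gaussQ (-x) = 1 / 2 + ∫ u in Set.Ioi (0 : ℝ),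
      Real.sin (u * T * x) / (Real.pi * u) * Real.exp (-((u * T) ^ 2 / 2)) := by
  have h := MeasureTheory.integral_comp_mul_right_Ioi
    (fun v => Real.sin (x * v) / (Real.pi * v) * Real.exp (-(v ^ 2 / 2))) 0 hT
  rw [zero_mul, smul_eq_mul] at h
  rw [gaussQ_neg_eq]
  congr 1
  have hT' : ∀ J I : ℝ, I = T⁻¹ * J → J = T * I := by
    intro J I h
    rw [h]; field_simp
  rw [hT' _ _ h, ← MeasureTheory.integral_const_mul]
  refine MeasureTheory.setIntegral_congr_fun measurableSet_Ioi fun v hv => ?_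
  have hv' : v ≠ 0 := (Set.mem_Ioi.1 hv).ne'
  rw [mul_comm x (v * T)]
  field_simp

theorem sum_mul_prawitzIntegrand {ι : Type*} [Fintype ι] (w s : ι → ℝ) (x T u : ℝ) :
    ∑ i, w i * prawitzIntegrand (T * (x - s i) / (2 * Real.pi)) u =
      ((-(1 - u : ℝ) + (prawitzKernel u : ℝ) * Complex.I)
        * Complex.exp ((-(u * T * x) : ℝ) * Complex.I) * finCharFun w s (u * T)).re := by
  have hp := Real.pi_pos
  rw [finCharFun, Finset.mul_sum, Complex.re_sum]
  refine Finset.sum_congr rfl fun i _ => ?_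
  have e : (-(1 - u : ℝ) + (prawitzKernel u : ℝ) * Complex.I)
      * Complex.exp ((-(u * T * x) : ℝ) * Complex.I)
      * ((w i : ℂ) * Complex.exp ((u * T * s i : ℝ) * Complex.I))
      = (w i : ℝ) * ((-(1 - u : ℝ) + (prawitzKernel u : ℝ) * Complex.I)
        * Complex.exp ((-(u * T * (x - s i)) : ℝ) * Complex.I)) := by
    have : Complex.exp ((-(u * T * (x - s i)) : ℝ) * Complex.I)
        = Complex.exp ((-(u * T * x) : ℝ) * Complex.I)
          * Complex.exp ((u * T * s i : ℝ) * Complex.I) := by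
      rw [← Complex.exp_add]; congr 1; push_cast; ring
    rw [this]
    ring
  rw [e, Complex.re_ofReal_mul]
  congr 1
  unfold prawitzIntegrand
  rw [show 2 * Real.pi * u * (T * (x - s i) / (2 * Real.pi)) = u * T * (x - s i) by field_simp]
  simp only [Complex.mul_re, Complex.add_re, Complex.add_im, Complex.neg_re, Complex.neg_im,
    Complex.exp_ofReal_mul_I_re, Complex.exp_ofReal_mul_I_im, Complex.ofReal_re,
    Complex.ofReal_im, Complex.mul_im, Complex.I_re, Complex.I_im, Real.cos_neg, Real.sin_neg]
  ring

theorem mul_sub_le_sum_mul_prawitzIntegrand {ι : Type*} [Fintype ι] (w s : ι → ℝ) (x T : ℝ)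
    {u k g : ℝ} (h0 : 0 < u) (h1 : u < 1) (hg : 0 ≤ g) (hk0 : 0 ≤ k)
    (hk : (1 - u) ^ 2 + prawitzKernel u ^ 2 ≤ k ^ 2) :
    Real.sin (u * T * x) / (Real.pi * u) * g - (1 - u + 55 / 100 * u ^ 2) * g
        - k * ‖finCharFun w s (u * T) - (g : ℝ)‖
      ≤ ∑ i, w i * prawitzIntegrand (T * (x - s i) / (2 * Real.pi)) u := by
  have hp := Real.pi_pos
  rw [sum_mul_prawitzIntegrand]
  set z := (-(1 - u : ℝ) + (prawitzKernel u : ℝ) * Complex.I : ℂ) with hz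
  set e := Complex.exp ((-(u * T * x) : ℝ) * Complex.I) with he
  set f := finCharFun w s (u * T)
  have hsplit : (z * e * f).re = (z * e).re * g + (z * e * (f - (g : ℝ))).re := by
    rw [← Complex.re_mul_ofReal, ← Complex.add_re]
    congr 1
    ring
  have hnz : ‖z‖ ≤ k := by
    refine (pow_le_pow_iff_left₀ (norm_nonneg _) hk0 two_ne_zero).1 (le_trans (le_of_eq ?_) hk)
    rw [← Complex.normSq_eq_norm_sq, Complex.normSq_apply, hz]
    simp only [Complex.add_re, Complex.add_im, Complex.neg_re, Complex.neg_im, Complex.mul_re,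
      Complex.mul_im, Complex.ofReal_re, Complex.ofReal_im, Complex.I_re, Complex.I_im]
    ring
  have herr : -(k * ‖f - (g : ℝ)‖) ≤ (z * e * (f - (g : ℝ))).re := by
    have h := Complex.abs_re_le_norm (z * e * (f - (g : ℝ)))
    rw [norm_mul, norm_mul, he, Complex.norm_exp_ofReal_mul_I, mul_one] at h
    have h2 := mul_le_mul_of_nonneg_right hnz (norm_nonneg (f - (g : ℝ)))
    linarith [neg_abs_le (z * e * (f - (g : ℝ))).re]
  have hmain : Real.sin (u * T * x) / (Real.pi * u) - (1 - u + 55 / 100 * u ^ 2)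
      ≤ (z * e).re := by
    have hre : (z * e).re = -(1 - u) * Real.cos (u * T * x)
        + prawitzKernel u * Real.sin (u * T * x) := by
      rw [hz, he]
      simp only [Complex.mul_re, Complex.add_re, Complex.add_im, Complex.neg_re, Complex.neg_im,
        Complex.exp_ofReal_mul_I_re, Complex.exp_ofReal_mul_I_im, Complex.ofReal_re,
        Complex.ofReal_im, Complex.mul_im, Complex.I_re, Complex.I_im, Real.cos_neg, Real.sin_neg]
      ring
    set θ := u * T * x
    have hq : 0 ≤ 1 - u + 55 / 100 * u ^ 2 := by nlinarith [sq_nonneg u]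
    have hsq := prawitzKernel_sub_sq_le h0 h1
    have hcs : ((1 - u) * Real.cos θ - (prawitzKernel u - 1 / (Real.pi * u)) * Real.sin θ) ^ 2
        ≤ (1 - u + 55 / 100 * u ^ 2) ^ 2 := by
      refine le_trans ?_ hsq
      have := Real.sin_sq_add_cos_sq θ
      have h3 : (1 - u) ^ 2 + (prawitzKernel u - 1 / (Real.pi * u)) ^ 2
          = ((1 - u) ^ 2 + (prawitzKernel u - 1 / (Real.pi * u)) ^ 2)
            * (Real.sin θ ^ 2 + Real.cos θ ^ 2) := by rw [this, mul_one]
      rw [h3]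
      nlinarith [sq_nonneg ((1 - u) * Real.sin θ
        + (prawitzKernel u - 1 / (Real.pi * u)) * Real.cos θ)]
    have := abs_le_of_sq_le_sq hcs hq
    have h4 := (abs_le.1 this).2
    rw [hre]
    have : Real.sin θ / (Real.pi * u) = 1 / (Real.pi * u) * Real.sin θ := by ring
    rw [this]
    linarith
  rw [hsplit]
  have := mul_le_mul_of_nonneg_right hmain hg
  rw [sub_mul] at this
  linarith

theorem sum_mul_prawitzMinorant_le {ι : Type*} [Fintype ι] {w s : ι → ℝ} (hw : ∀ i, 0 ≤ w i)
    (x : ℝ) {T : ℝ} (hT : 0 < T) :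
    ∑ i, w i * prawitzMinorant (T * (x - s i) / (2 * Real.pi))
      ≤ ∑ i, w i * (if s i ≤ x then 1 else 0) := by
  have hp := Real.pi_pos
  refine Finset.sum_le_sum fun i _ => mul_le_mul_of_nonneg_left ?_ (hw i)
  split_ifs with h
  · exact prawitzMinorant_le_one_of_nonneg
      (div_nonneg (mul_nonneg hT.le (sub_nonneg.2 h)) (by positivity))
  · refine prawitzMinorant_nonpos_of_neg (div_neg_of_neg_of_pos ?_ (by positivity))
    exact mul_neg_of_pos_of_neg hT (by linarith)

theorem sum_mul_prawitzMinorant_eq {ι : Type*} [Fintype ι] {w s : ι → ℝ} (h1 : ∑ i, w i = 1)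
    (x T : ℝ) :
    ∑ i, w i * prawitzMinorant (T * (x - s i) / (2 * Real.pi)) = 1 / 2 + ∫ u in (0 : ℝ)..1,
      ∑ i, w i * prawitzIntegrand (T * (x - s i) / (2 * Real.pi)) u := by
  rw [intervalIntegral.integral_finsetSum
    fun i _ => (intervalIntegrable_prawitzIntegrand _).const_mul _]
  simp only [prawitzMinorant, mul_add, intervalIntegral.integral_const_mul,
    Finset.sum_add_distrib, ← Finset.sum_mul, h1, one_mul]

theorem integral_quadratic_mul_exp_neg_sq {T : ℝ} (hT : 0 < T) :
    MeasureTheory.IntegrableOn (fun u : ℝ => (1 - u + 55 / 100 * u ^ 2)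
        * Real.exp (-((u * T) ^ 2 / 2))) (Set.Ioi (0 : ℝ)) ∧
    ∫ u in Set.Ioi (0 : ℝ), (1 - u + 55 / 100 * u ^ 2) * Real.exp (-((u * T) ^ 2 / 2))
      = Real.sqrt (Real.pi / 2) * (1 / T + 55 / 100 / T ^ 3) - 1 / T ^ 2 := by
  have hb : 0 < T ^ 2 / 2 := by positivity
  have i0 := integrableOn_pow_mul_exp_neg_mul_sq hb 0
  have i1 := integrableOn_pow_mul_exp_neg_mul_sq hb 1
  have i2 := integrableOn_pow_mul_exp_neg_mul_sq hb 2
  simp only [pow_zero, one_mul, pow_one] at i0 i1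
  have e : (fun u : ℝ => (1 - u + 55 / 100 * u ^ 2) * Real.exp (-((u * T) ^ 2 / 2)))
      = fun u : ℝ => Real.exp (-(T ^ 2 / 2 * u ^ 2)) - u * Real.exp (-(T ^ 2 / 2 * u ^ 2))
        + 55 / 100 * (u ^ 2 * Real.exp (-(T ^ 2 / 2 * u ^ 2))) := by
    funext u
    rw [show (u * T) ^ 2 / 2 = T ^ 2 / 2 * u ^ 2 by ring]
    ring
  have hr : Real.sqrt (Real.pi / (T ^ 2 / 2)) = 2 * Real.sqrt (Real.pi / 2) / T := by
    rw [show Real.pi / (T ^ 2 / 2) = (2 / T) ^ 2 * (Real.pi / 2) by field_simp,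
      Real.sqrt_mul (by positivity), Real.sqrt_sq (by positivity)]
    ring
  have i01 : MeasureTheory.IntegrableOn (fun u : ℝ => Real.exp (-(T ^ 2 / 2 * u ^ 2))
      - u * Real.exp (-(T ^ 2 / 2 * u ^ 2))) (Set.Ioi (0 : ℝ)) := i0.sub i1
  rw [e]
  refine ⟨i01.add (i2.const_mul _), ?_⟩
  rw [MeasureTheory.integral_add i01 (i2.const_mul _), MeasureTheory.integral_sub i0 i1,
    MeasureTheory.integral_const_mul, integral_exp_neg_mul_sq_Ioi,
    integral_mul_exp_neg_mul_sq_Ioi hb, integral_sq_mul_exp_neg_mul_sq_Ioi hb, hr]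
  field_simp
  ring

theorem abs_sin_mul_div_le {u : ℝ} (hu : 0 < u) (T x : ℝ) :
    |Real.sin (u * T * x) / (Real.pi * u)| ≤ |T * x| / Real.pi := by
  have hp := Real.pi_pos
  have h : |Real.sin (u * T * x)| ≤ u * |T * x| := by
    refine Real.abs_sin_le_abs.trans (le_of_eq ?_)
    rw [mul_assoc, abs_mul, abs_of_pos hu]
  rw [abs_div, abs_of_pos (by positivity : 0 < Real.pi * u), div_le_div_iff₀ (by positivity) hp]
  nlinarith

/-- The Prawitz smoothing inequality for a finitely supported law compared to the standard
Gaussian. -/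
theorem gaussQ_neg_le_of_finCharFun {ι : Type*} [Fintype ι] {w s : ι → ℝ} (hw : ∀ i, 0 ≤ w i)
    (h1 : ∑ i, w i = 1) (x : ℝ) {T : ℝ} (hT : 0 < T) {E : ℝ → ℝ}
    (hE : IntervalIntegrable E MeasureTheory.volume 0 1)
    (hbound : ∀ u, 0 < u → u < 1 → ∃ k, 0 ≤ k ∧ (1 - u) ^ 2 + prawitzKernel u ^ 2 ≤ k ^ 2 ∧
      k * ‖finCharFun w s (u * T) - (Real.exp (-((u * T) ^ 2 / 2)) : ℝ)‖ ≤ E u) :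
    gaussQ (-x) ≤ ∑ i, w i * (if s i ≤ x then 1 else 0)
      + (Real.sqrt (Real.pi / 2) * (1 / T + 55 / 100 / T ^ 3) - 1 / T ^ 2)
      + ∫ u in (0 : ℝ)..1, E u := by
  have hp := Real.pi_pos
  set g : ℝ → ℝ := fun u => Real.exp (-((u * T) ^ 2 / 2)) with hg
  obtain ⟨hqi, hq⟩ := integral_quadratic_mul_exp_neg_sq hT
  have hgi : MeasureTheory.IntegrableOn g (Set.Ioi (0 : ℝ)) := by
    have := integrableOn_pow_mul_exp_neg_mul_sq (b := T ^ 2 / 2) (by positivity) 0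
    refine this.congr_fun (fun u _ => ?_) measurableSet_Ioi
    simp only [hg, pow_zero, one_mul]
    congr 1
    ring
  have hsi : MeasureTheory.IntegrableOn (fun u => Real.sin (u * T * x) / (Real.pi * u) * g u)
      (Set.Ioi (0 : ℝ)) := by
    refine (hgi.const_mul (|T * x| / Real.pi)).mono' (Measurable.aestronglyMeasurable (by fun_prop))
      ?_
    rw [MeasureTheory.ae_restrict_iff' measurableSet_Ioi]
    refine Filter.Eventually.of_forall fun u hu => ?_
    rw [norm_mul, Real.norm_eq_abs, Real.norm_eq_abs, abs_of_pos (Real.exp_pos _)]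
    exact mul_le_mul_of_nonneg_right (abs_sin_mul_div_le hu T x) (Real.exp_pos _).le
  set φ : ℝ → ℝ := fun u => Real.sin (u * T * x) / (Real.pi * u) * g u
    - (1 - u + 55 / 100 * u ^ 2) * g u with hφ
  have hφi : MeasureTheory.IntegrableOn φ (Set.Ioi (0 : ℝ)) := hsi.sub hqi
  have hφI : ∫ u in Set.Ioi (0 : ℝ), φ u = gaussQ (-x) - 1 / 2
      - (Real.sqrt (Real.pi / 2) * (1 / T + 55 / 100 / T ^ 3) - 1 / T ^ 2) := by
    rw [hφ, MeasureTheory.integral_sub hsi hqi, hq, gaussQ_neg_eq_comp_mul x hT]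
    ring
  have hφ01 : IntervalIntegrable φ MeasureTheory.volume 0 1 := by
    rw [intervalIntegrable_iff_integrableOn_Ioc_of_le zero_le_one]
    exact hφi.mono_set Set.Ioc_subset_Ioi_self
  have hφtail : ∫ u in Set.Ioi (0 : ℝ), φ u ≤ ∫ u in (0 : ℝ)..1, φ u := by
    rw [← intervalIntegral.integral_interval_add_Ioi hφi
      (hφi.mono_set (Set.Ioi_subset_Ioi zero_le_one))]
    refine add_le_of_nonpos_right
      (MeasureTheory.setIntegral_nonpos measurableSet_Ioi fun u hu => ?_)
    have hu' : 1 < u := hu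
    have h2 : Real.sin (u * T * x) / (Real.pi * u) ≤ 1 - u + 55 / 100 * u ^ 2 := by
      rw [div_le_iff₀ (by positivity)]
      have hpu : 3 * u ≤ Real.pi * u := by nlinarith [Real.pi_gt_three]
      have : 0.54 ≤ 1 - u + 55 / 100 * u ^ 2 := by nlinarith [sq_nonneg (u - 10 / 11)]
      nlinarith [Real.sin_le_one (u * T * x)]
    have h3 := mul_le_mul_of_nonneg_right h2 (Real.exp_pos (-((u * T) ^ 2 / 2))).le
    simp only [hφ, hg]
    linarith
  have hle : ∫ u in (0 : ℝ)..1, (φ u - E u)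
      ≤ ∫ u in (0 : ℝ)..1, ∑ i, w i * prawitzIntegrand (T * (x - s i) / (2 * Real.pi)) u := by
    refine intervalIntegral.integral_mono_on_of_le_Ioo zero_le_one (hφ01.sub hE) ?_ ?_
    · simpa only [Finset.sum_fn] using IntervalIntegrable.sum Finset.univ
        (f := fun i u => w i * prawitzIntegrand (T * (x - s i) / (2 * Real.pi)) u)
        fun i _ => (intervalIntegrable_prawitzIntegrand _).const_mul _
    · intro u hu
      obtain ⟨k, hk0, hk, hkE⟩ := hbound u hu.1 hu.2
      have := mul_sub_le_sum_mul_prawitzIntegrand w s x T hu.1 hu.2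
        (Real.exp_pos (-((u * T) ^ 2 / 2))).le hk0 hk
      simp only [hφ, hg]
      linarith
  rw [intervalIntegral.integral_sub hφ01 hE] at hle
  have hm := sum_mul_prawitzMinorant_le (s := s) hw x hT
  rw [sum_mul_prawitzMinorant_eq h1] at hm
  linarith

/-- The exponential factor bounding the distance between the characteristic function of a
normalized sum and the Gaussian one. -/
noncomputable def expDamping (M z : ℝ) : ℝ :=
  (Real.exp (-(M * (z ^ 2 / 2))) + Real.exp (-(M * (z ^ 2 / 2 - z ^ 3 / 5)))) / 2

/-- The polynomial weight of the smoothing error on `[0, 1/2]`. -/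
noncomputable def lowWeight (u : ℝ) : ℝ :=
  33 / 100 * (4913 / 6000 * u ^ 2 + 83521 / 80000 * u ^ 3)

/-- The polynomial weight of the smoothing error on `[1/2, 1]`. -/
noncomputable def highWeight (u : ℝ) : ℝ :=
  (1 - u) * (1 + (1 - u) ^ 2) * (4913 / 6000 * u ^ 3 + 83521 / 80000 * u ^ 4)

theorem continuous_expDamping (M : ℝ) : Continuous fun u : ℝ => expDamping M (17 / 10 * u) := by
  unfold expDamping
  fun_prop

theorem continuous_lowWeight : Continuous lowWeight := by
  unfold lowWeight
  fun_prop

theorem continuous_highWeight : Continuous highWeight := by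
  unfold highWeight
  fun_prop

theorem expDamping_le {M a u : ℝ} (hM : 0 ≤ M) (ha : 0 ≤ a) (ha' : a ≤ 3 / 4) (hau : a ≤ u)
    (hu : u ≤ 1) : expDamping M (17 / 10 * u) ≤ expDamping M (17 / 10 * a) := by
  unfold expDamping
  have h1 : (17 / 10 * a) ^ 2 / 2 ≤ (17 / 10 * u) ^ 2 / 2 := by gcongr
  have h2 : (17 / 10 * a) ^ 2 / 2 - (17 / 10 * a) ^ 3 / 5
      ≤ (17 / 10 * u) ^ 2 / 2 - (17 / 10 * u) ^ 3 / 5 := by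
    have hu0 : 0 ≤ u := ha.trans hau
    have h : 0 ≤ 85 / 100 * (u + a) - 578 / 1000 * (u ^ 2 + u * a + a ^ 2) := by
      nlinarith [mul_nonneg hu0 (sub_nonneg.2 hu), mul_nonneg ha (sub_nonneg.2 hu),
        mul_nonneg ha (sub_nonneg.2 ha')]
    nlinarith [mul_nonneg (sub_nonneg.2 hau) h]
  have e1 := mul_le_mul_of_nonneg_left h1 hM
  have e2 := mul_le_mul_of_nonneg_left h2 hM
  have := Real.exp_le_exp.2 (neg_le_neg e1)
  have := Real.exp_le_exp.2 (neg_le_neg e2)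
  linarith

theorem integral_mul_le_of_forall_le {W D : ℝ → ℝ} (hW : Continuous W) (hD : Continuous D)
    {a b d : ℝ} (hab : a ≤ b) (hW0 : ∀ u, a ≤ u → u ≤ b → 0 ≤ W u)
    (hd : ∀ u, a ≤ u → u ≤ b → D u ≤ d) :
    ∫ u in a..b, W u * D u ≤ (∫ u in a..b, W u) * d := by
  rw [← intervalIntegral.integral_mul_const]
  refine intervalIntegral.integral_mono_on hab ((hW.mul hD).intervalIntegrable _ _)
    ((hW.mul continuous_const).intervalIntegrable _ _) fun u hu => ?_
  exact mul_le_mul_of_nonneg_left (hd u hu.1 hu.2) (hW0 u hu.1 hu.2)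

theorem integral_lowWeight (a b : ℝ) : ∫ u in a..b, lowWeight u
    = 33 / 100 * (4913 / 18000 * b ^ 3 + 83521 / 320000 * b ^ 4)
      - 33 / 100 * (4913 / 18000 * a ^ 3 + 83521 / 320000 * a ^ 4) := by
  refine intervalIntegral.integral_eq_sub_of_hasDerivAt
    (f := fun u => 33 / 100 * (4913 / 18000 * u ^ 3 + 83521 / 320000 * u ^ 4)) (fun u _ => ?_)
    (continuous_lowWeight.intervalIntegrable _ _)
  have h := (((hasDerivAt_pow 3 u).const_mul (4913 / 18000)).add
    ((hasDerivAt_pow 4 u).const_mul (83521 / 320000))).const_mul (33 / 100)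
  refine HasDerivAt.congr_deriv h ?_
  unfold lowWeight
  norm_num
  ring

theorem integral_highWeight (a b : ℝ) : ∫ u in a..b, highWeight u
    = (4913 / 6000 * (b ^ 4 / 2 - 4 / 5 * b ^ 5 + b ^ 6 / 2 - b ^ 7 / 7)
        + 83521 / 80000 * (2 / 5 * b ^ 5 - 2 / 3 * b ^ 6 + 3 / 7 * b ^ 7 - b ^ 8 / 8))
      - (4913 / 6000 * (a ^ 4 / 2 - 4 / 5 * a ^ 5 + a ^ 6 / 2 - a ^ 7 / 7)
        + 83521 / 80000 * (2 / 5 * a ^ 5 - 2 / 3 * a ^ 6 + 3 / 7 * a ^ 7 - a ^ 8 / 8)) := by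
  refine intervalIntegral.integral_eq_sub_of_hasDerivAt
    (f := fun u => 4913 / 6000 * (u ^ 4 / 2 - 4 / 5 * u ^ 5 + u ^ 6 / 2 - u ^ 7 / 7)
        + 83521 / 80000 * (2 / 5 * u ^ 5 - 2 / 3 * u ^ 6 + 3 / 7 * u ^ 7 - u ^ 8 / 8))
    (fun u _ => ?_) (continuous_highWeight.intervalIntegrable _ _)
  have p4 := hasDerivAt_pow 4 u
  have p5 := hasDerivAt_pow 5 u
  have p6 := hasDerivAt_pow 6 u
  have p7 := hasDerivAt_pow 7 u
  have p8 := hasDerivAt_pow 8 u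
  have h := ((((p4.div_const 2).sub (p5.const_mul (4 / 5))).add (p6.div_const 2)).sub
    (p7.div_const 7)).const_mul (4913 / 6000) |>.add
    (((((p5.const_mul (2 / 5)).sub (p6.const_mul (2 / 3))).add (p7.const_mul (3 / 7))).sub
    (p8.div_const 8)).const_mul (83521 / 80000))
  refine HasDerivAt.congr_deriv h ?_
  unfold highWeight
  norm_num
  ring

theorem lowWeight_nonneg {u : ℝ} (hu : 0 ≤ u) : 0 ≤ lowWeight u := by
  unfold lowWeight
  positivity

theorem highWeight_nonneg {u : ℝ} (hu : 0 ≤ u) (hu' : u ≤ 1) : 0 ≤ highWeight u := by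
  unfold highWeight
  have := sub_nonneg.2 hu'
  positivity

theorem integral_lowWeight_mul_expDamping_le {M a b : ℝ} (hM : 0 ≤ M) (ha : 0 ≤ a)
    (ha' : a ≤ 3 / 4) (hab : a ≤ b) (hb : b ≤ 1) :
    ∫ u in a..b, lowWeight u * expDamping M (17 / 10 * u)
      ≤ (∫ u in a..b, lowWeight u) * expDamping M (17 / 10 * a) :=
  integral_mul_le_of_forall_le continuous_lowWeight (continuous_expDamping M) hab
    (fun _ h _ => lowWeight_nonneg (ha.trans h))
    fun _ h h' => expDamping_le hM ha ha' h (h'.trans hb)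

theorem integral_highWeight_mul_expDamping_le {M a b : ℝ} (hM : 0 ≤ M) (ha : 0 ≤ a)
    (ha' : a ≤ 3 / 4) (hab : a ≤ b) (hb : b ≤ 1) :
    ∫ u in a..b, highWeight u * expDamping M (17 / 10 * u)
      ≤ (∫ u in a..b, highWeight u) * expDamping M (17 / 10 * a) :=
  integral_mul_le_of_forall_le continuous_highWeight (continuous_expDamping M) hab
    (fun _ h h' => highWeight_nonneg (ha.trans h) (h'.trans hb))
    fun _ h h' => expDamping_le hM ha ha' h (h'.trans hb)

theorem exp_neg_le_of_one_le_mul_sum {x r : ℝ} (hx : 0 ≤ x) (m : ℕ) (hr : 0 ≤ r)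
    (h : 1 ≤ r * ∑ i ∈ Finset.range m, x ^ i / (i.factorial : ℝ)) : Real.exp (-x) ≤ r := by
  have h2 := mul_le_mul_of_nonneg_left (Real.sum_le_exp_of_nonneg hx m) hr
  rw [Real.exp_neg, inv_le_iff_one_le_mul₀ (Real.exp_pos x)]
  linarith

theorem expDamping_le_chord {z A₁ A₂ B₁ B₂ M : ℝ} (hM : 7 / 3 ≤ M) (hM' : M ≤ 7)
    (hA₁ : Real.exp (-(7 / 3 * (z ^ 2 / 2))) ≤ A₁)
    (hA₂ : Real.exp (-(7 / 3 * (z ^ 2 / 2 - z ^ 3 / 5))) ≤ A₂)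
    (hB₁ : Real.exp (-(7 * (z ^ 2 / 2))) ≤ B₁)
    (hB₂ : Real.exp (-(7 * (z ^ 2 / 2 - z ^ 3 / 5))) ≤ B₂) :
    expDamping M z ≤ ((7 - M) * (A₁ + A₂) + (M - 7 / 3) * (B₁ + B₂)) * (3 / 28) := by
  have key : ∀ p A B : ℝ, Real.exp (-(7 / 3 * p)) ≤ A → Real.exp (-(7 * p)) ≤ B →
      Real.exp (-(M * p)) ≤ ((7 - M) * A + (M - 7 / 3) * B) * (3 / 14) := by
    intro p A B hA hB
    have c1 : 0 ≤ (7 - M) * (3 / 14) := by linarith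
    have c2 : 0 ≤ (M - 7 / 3) * (3 / 14) := by linarith
    have h := convexOn_exp.right (Set.mem_univ (-(7 / 3 * p))) (Set.mem_univ (-(7 * p))) c1 c2
      (by ring)
    simp only [smul_eq_mul] at h
    rw [show (7 - M) * (3 / 14) * -(7 / 3 * p) + (M - 7 / 3) * (3 / 14) * -(7 * p) = -(M * p)
      by ring] at h
    have h1 := mul_le_mul_of_nonneg_left hA (sub_nonneg.2 hM')
    have h2 := mul_le_mul_of_nonneg_left hB (sub_nonneg.2 hM)
    linarith
  have h1 := key _ _ _ hA₁ hB₁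
  have h2 := key _ _ _ hA₂ hB₂
  unfold expDamping
  linarith

/-- The smoothing error for a moderate Lyapunov ratio. -/
theorem integral_error_le_of_moderate {M : ℝ} (hM : 7 / 3 ≤ M) (hM' : M ≤ 7) :
    (∫ u in (0 : ℝ)..(1 / 2), lowWeight u * expDamping M (17 / 10 * u))
      + ∫ u in (1 / 2 : ℝ)..1, highWeight u * expDamping M (17 / 10 * u)
      ≤ ((7 - M) * (373 / 10000) + (M - 7 / 3) * (122 / 10000)) * (3 / 14) := by
  have hM0 : 0 ≤ M := by linarith
  have il : ∀ a b : ℝ, IntervalIntegrable (fun u => lowWeight u * expDamping M (17 / 10 * u))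
      MeasureTheory.volume a b := fun a b =>
    (continuous_lowWeight.mul (continuous_expDamping M)).intervalIntegrable a b
  have ih : ∀ a b : ℝ, IntervalIntegrable (fun u => highWeight u * expDamping M (17 / 10 * u))
      MeasureTheory.volume a b := fun a b =>
    (continuous_highWeight.mul (continuous_expDamping M)).intervalIntegrable a b
  rw [← intervalIntegral.integral_add_adjacent_intervals (il 0 (1 / 4)) (il (1 / 4) (1 / 2)),
    ← intervalIntegral.integral_add_adjacent_intervals (il (1 / 4) (2 / 5)) (il (2 / 5) (1 / 2)),
    ← intervalIntegral.integral_add_adjacent_intervals (ih (1 / 2) (3 / 5)) (ih (3 / 5) 1),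
    ← intervalIntegral.integral_add_adjacent_intervals (ih (3 / 5) (3 / 4)) (ih (3 / 4) 1)]
  have i1 := integral_lowWeight_mul_expDamping_le (a := 0) (b := 1 / 4) hM0 (by norm_num)
    (by norm_num) (by norm_num) (by norm_num)
  have i2 := integral_lowWeight_mul_expDamping_le (a := 1 / 4) (b := 2 / 5) hM0 (by norm_num)
    (by norm_num) (by norm_num) (by norm_num)
  have i3 := integral_lowWeight_mul_expDamping_le (a := 2 / 5) (b := 1 / 2) hM0 (by norm_num)
    (by norm_num) (by norm_num) (by norm_num)
  have i4 := integral_highWeight_mul_expDamping_le (a := 1 / 2) (b := 3 / 5) hM0 (by norm_num)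
    (by norm_num) (by norm_num) (by norm_num)
  have i5 := integral_highWeight_mul_expDamping_le (a := 3 / 5) (b := 3 / 4) hM0 (by norm_num)
    (by norm_num) (by norm_num) (by norm_num)
  have i6 := integral_highWeight_mul_expDamping_le (a := 3 / 4) (b := 1) hM0 (by norm_num)
    (by norm_num) (by norm_num) (by norm_num)
  have d1 : expDamping M (17 / 10 * 0) = 1 := by
    unfold expDamping
    norm_num
  have d2 := expDamping_le_chord (z := 17 / 10 * (1 / 4)) (A₁ := 811 / 1000) (A₂ := 840 / 1000)
    (B₁ := 532 / 1000) (B₂ := 592 / 1000) hM hM'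
    (exp_neg_le_of_one_le_mul_sum (by norm_num) 8 (by norm_num)
      (by norm_num [Finset.sum_range_succ, Nat.factorial]))
    (exp_neg_le_of_one_le_mul_sum (by norm_num) 8 (by norm_num)
      (by norm_num [Finset.sum_range_succ, Nat.factorial]))
    (exp_neg_le_of_one_le_mul_sum (by norm_num) 8 (by norm_num)
      (by norm_num [Finset.sum_range_succ, Nat.factorial]))
    (exp_neg_le_of_one_le_mul_sum (by norm_num) 8 (by norm_num)
      (by norm_num [Finset.sum_range_succ, Nat.factorial]))
  have d3 := expDamping_le_chord (z := 17 / 10 * (2 / 5)) (A₁ := 584 / 1000) (A₂ := 676 / 1000)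
    (B₁ := 199 / 1000) (B₂ := 308 / 1000) hM hM'
    (exp_neg_le_of_one_le_mul_sum (by norm_num) 8 (by norm_num)
      (by norm_num [Finset.sum_range_succ, Nat.factorial]))
    (exp_neg_le_of_one_le_mul_sum (by norm_num) 8 (by norm_num)
      (by norm_num [Finset.sum_range_succ, Nat.factorial]))
    (exp_neg_le_of_one_le_mul_sum (by norm_num) 8 (by norm_num)
      (by norm_num [Finset.sum_range_succ, Nat.factorial]))
    (exp_neg_le_of_one_le_mul_sum (by norm_num) 8 (by norm_num)
      (by norm_num [Finset.sum_range_succ, Nat.factorial]))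
  have d4 := expDamping_le_chord (z := 17 / 10 * (1 / 2)) (A₁ := 431 / 1000) (A₂ := 574 / 1000)
    (B₁ := 81 / 1000) (B₂ := 189 / 1000) hM hM'
    (exp_neg_le_of_one_le_mul_sum (by norm_num) 8 (by norm_num)
      (by norm_num [Finset.sum_range_succ, Nat.factorial]))
    (exp_neg_le_of_one_le_mul_sum (by norm_num) 8 (by norm_num)
      (by norm_num [Finset.sum_range_succ, Nat.factorial]))
    (exp_neg_le_of_one_le_mul_sum (by norm_num) 8 (by norm_num)
      (by norm_num [Finset.sum_range_succ, Nat.factorial]))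
    (exp_neg_le_of_one_le_mul_sum (by norm_num) 8 (by norm_num)
      (by norm_num [Finset.sum_range_succ, Nat.factorial]))
  have d5 := expDamping_le_chord (z := 17 / 10 * (3 / 5)) (A₁ := 298 / 1000) (A₂ := 488 / 1000)
    (B₁ := 29 / 1000) (B₂ := 117 / 1000) hM hM'
    (exp_neg_le_of_one_le_mul_sum (by norm_num) 8 (by norm_num)
      (by norm_num [Finset.sum_range_succ, Nat.factorial]))
    (exp_neg_le_of_one_le_mul_sum (by norm_num) 8 (by norm_num)
      (by norm_num [Finset.sum_range_succ, Nat.factorial]))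
    (exp_neg_le_of_one_le_mul_sum (by norm_num) 8 (by norm_num)
      (by norm_num [Finset.sum_range_succ, Nat.factorial]))
    (exp_neg_le_of_one_le_mul_sum (by norm_num) 8 (by norm_num)
      (by norm_num [Finset.sum_range_succ, Nat.factorial]))
  have d6 := expDamping_le_chord (z := 17 / 10 * (3 / 4)) (A₁ := 151 / 1000) (A₂ := 396 / 1000)
    (B₁ := 5 / 1000) (B₂ := 63 / 1000) hM hM'
    (exp_neg_le_of_one_le_mul_sum (by norm_num) 8 (by norm_num)
      (by norm_num [Finset.sum_range_succ, Nat.factorial]))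
    (exp_neg_le_of_one_le_mul_sum (by norm_num) 8 (by norm_num)
      (by norm_num [Finset.sum_range_succ, Nat.factorial]))
    (exp_neg_le_of_one_le_mul_sum (by norm_num) 8 (by norm_num)
      (by norm_num [Finset.sum_range_succ, Nat.factorial]))
    (exp_neg_le_of_one_le_mul_sum (by norm_num) 8 (by norm_num)
      (by norm_num [Finset.sum_range_succ, Nat.factorial]))
  rw [integral_lowWeight] at i1 i2 i3
  rw [integral_highWeight] at i4 i5 i6
  norm_num at i1 i2 i3 i4 i5 i6 d1 d2 d3 d4 d5 d6 ⊢
  rw [d1] at i1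
  linarith

theorem exp_neg_le_div_sq {x : ℝ} (hx : 0 < x) : Real.exp (-x) ≤ 5414 / 10000 / x ^ 2 := by
  have h1 : x / 2 ≤ Real.exp (x / 2 - 1) := by linarith [Real.add_one_le_exp (x / 2 - 1)]
  have h2 : (x / 2) ^ 2 ≤ Real.exp (x / 2 - 1) ^ 2 := by gcongr
  have h3 : Real.exp (x / 2 - 1) ^ 2 * Real.exp 1 ^ 2 * Real.exp (-x) = 1 := by
    simp only [← Real.exp_nat_mul, ← Real.exp_add]
    rw [Real.exp_eq_one_iff]
    push_cast
    ring
  have h4 : 7.389 ≤ Real.exp 1 ^ 2 := by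
    have := Real.exp_one_gt_d9
    nlinarith
  rw [le_div_iff₀ (by positivity)]
  have h5 := mul_le_mul_of_nonneg_right (mul_le_mul h2 h4 (by norm_num) (by positivity))
    (Real.exp_pos (-x)).le
  rw [h3] at h5
  linarith

theorem seven_div_le {L : ℝ} (hL : 0 < L) (hL' : L ^ 2 ≤ 1 / 8) :
    7 / 8 / L ^ 2 ≤ 1 / L ^ 2 - 1 := by
  have : 0 < L ^ 2 := by positivity
  rw [div_le_iff₀ this, sub_mul, div_mul_cancel₀ _ this.ne']
  linarith

theorem exp_neg_mul_le_of_small {L p : ℝ} (hL : 0 < L) (hL' : L ^ 2 ≤ 1 / 8) (hp : 0 < p) :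
    Real.exp (-((1 / L ^ 2 - 1) * p)) ≤ 7072 / 10000 / p ^ 2 * L ^ 4 := by
  have h := mul_le_mul_of_nonneg_right (seven_div_le hL hL') hp.le
  refine ((Real.exp_le_exp.2 (neg_le_neg h)).trans
    (exp_neg_le_div_sq (by positivity))).trans ?_
  rw [show 5414 / 10000 / (7 / 8 / L ^ 2 * p) ^ 2 = 5414 / 10000 * (64 / 49) / p ^ 2 * L ^ 4 by
    field_simp
    norm_num]
  gcongr
  norm_num

theorem expDamping_le_of_small {L z q : ℝ} (hL : 0 < L) (hL' : L ^ 2 ≤ 1 / 8) (hz : 0 < z)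
    (hz' : z < 5 / 2) (hq : 3536 / 10000 / (z ^ 2 / 2) ^ 2
      + 3536 / 10000 / (z ^ 2 / 2 - z ^ 3 / 5) ^ 2 ≤ q) :
    expDamping (1 / L ^ 2 - 1) z ≤ q * L ^ 4 := by
  have h1 := exp_neg_mul_le_of_small hL hL' (p := z ^ 2 / 2) (by positivity)
  have h2 := exp_neg_mul_le_of_small hL hL' (p := z ^ 2 / 2 - z ^ 3 / 5)
    (by nlinarith [sq_pos_of_pos hz])
  have h3 := mul_le_mul_of_nonneg_right hq (by positivity : 0 ≤ L ^ 4)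
  unfold expDamping
  refine le_trans (div_le_div_of_nonneg_right (add_le_add h1 h2) zero_le_two)
    (le_trans (le_of_eq ?_) h3)
  ring

theorem integral_lowWeight_mul_exp_le {L k r : ℝ} (hL : 0 < L) (hk : 0 < k) (hr : 0 ≤ r)
    (hr' : Real.pi / k ≤ r ^ 2) :
    ∫ u in (0 : ℝ)..(1 / 2), lowWeight u * Real.exp (-(k / L ^ 2 * u ^ 2))
      ≤ 33 / 100 * (4913 / 6000 * (r / (4 * k)) * L ^ 3
        + 83521 / 80000 * (1 / (2 * k ^ 2)) * L ^ 4) := by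
  have hb : 0 < k / L ^ 2 := by positivity
  have i2 := integrableOn_pow_mul_exp_neg_mul_sq hb 2
  have i3 := integrableOn_pow_mul_exp_neg_mul_sq hb 3
  have e : (fun u : ℝ => lowWeight u * Real.exp (-(k / L ^ 2 * u ^ 2)))
      = fun u : ℝ => 33 / 100 * (4913 / 6000) * (u ^ 2 * Real.exp (-(k / L ^ 2 * u ^ 2)))
        + 33 / 100 * (83521 / 80000) * (u ^ 3 * Real.exp (-(k / L ^ 2 * u ^ 2))) := by
    funext u
    unfold lowWeight
    ring
  have hi := (i2.const_mul (33 / 100 * (4913 / 6000))).add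
    (i3.const_mul (33 / 100 * (83521 / 80000)))
  have hI := MeasureTheory.integral_add (i2.const_mul (33 / 100 * (4913 / 6000)))
    (i3.const_mul (33 / 100 * (83521 / 80000)))
  rw [MeasureTheory.integral_const_mul, MeasureTheory.integral_const_mul,
    integral_sq_mul_exp_neg_mul_sq_Ioi hb, integral_cube_mul_exp_neg_mul_sq_Ioi hb] at hI
  have hs : Real.sqrt (Real.pi / (k / L ^ 2)) ≤ r * L := by
    refine Real.sqrt_le_iff.2 ⟨by positivity, ?_⟩
    rw [mul_pow, div_div_eq_mul_div, mul_div_right_comm]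
    gcongr
  rw [intervalIntegral.integral_of_le (by norm_num), e]
  refine (MeasureTheory.setIntegral_mono_set hi ?_
    Set.Ioc_subset_Ioi_self.eventuallyLE).trans ?_
  · rw [Filter.EventuallyLE, MeasureTheory.ae_restrict_iff' measurableSet_Ioi]
    refine Filter.Eventually.of_forall fun u hu => ?_
    have hu0 : (0 : ℝ) < u := hu
    simp only [Pi.zero_apply, Pi.add_apply]
    positivity
  · refine hI.le.trans ?_
    have h4 := div_le_div_of_nonneg_right hs (by positivity : 0 ≤ 4 * (k / L ^ 2))
    have e1 : r * L / (4 * (k / L ^ 2)) = r / (4 * k) * L ^ 3 := by field_simp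
    have e2 : 1 / (2 * (k / L ^ 2) ^ 2) = 1 / (2 * k ^ 2) * L ^ 4 := by field_simp
    rw [e1] at h4
    rw [e2]
    linarith

/-- The smoothing error for a small Lyapunov ratio. -/
theorem integral_error_le_of_small {L : ℝ} (hL : 0 < L) (hL' : L ^ 2 ≤ 1 / 8) :
    (∫ u in (0 : ℝ)..(1 / 2), lowWeight u * expDamping (1 / L ^ 2 - 1) (17 / 10 * u))
      + ∫ u in (1 / 2 : ℝ)..1, highWeight u * expDamping (1 / L ^ 2 - 1) (17 / 10 * u)
      ≤ 1208 / 10000 * L ^ 3 + 602 / 1000 * L ^ 4 := by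
  have h7 := seven_div_le hL hL'
  have hM0 : 0 ≤ 1 / L ^ 2 - 1 := le_trans (by positivity) h7
  have ih : ∀ a b : ℝ, IntervalIntegrable
      (fun u => highWeight u * expDamping (1 / L ^ 2 - 1) (17 / 10 * u))
      MeasureTheory.volume a b := fun a b =>
    (continuous_highWeight.mul (continuous_expDamping _)).intervalIntegrable a b
  have hlow : ∫ u in (0 : ℝ)..(1 / 2), lowWeight u * expDamping (1 / L ^ 2 - 1) (17 / 10 * u)
      ≤ (∫ u in (0 : ℝ)..(1 / 2), lowWeight u
          * Real.exp (-(7 / 8 * (289 / 200) / L ^ 2 * u ^ 2))) * (1 / 2)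
        + (∫ u in (0 : ℝ)..(1 / 2), lowWeight u
          * Real.exp (-(7 / 8 * (9537 / 10000) / L ^ 2 * u ^ 2))) * (1 / 2) := by
    have ic : ∀ b : ℝ, IntervalIntegrable
        (fun u => lowWeight u * Real.exp (-(b / L ^ 2 * u ^ 2)) * (1 / 2))
        MeasureTheory.volume 0 (1 / 2) := fun b =>
      ((continuous_lowWeight.mul (by fun_prop)).mul continuous_const).intervalIntegrable _ _
    rw [← intervalIntegral.integral_mul_const, ← intervalIntegral.integral_mul_const,
      ← intervalIntegral.integral_add (ic _) (ic _)]
    refine intervalIntegral.integral_mono_on (by norm_num)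
      ((continuous_lowWeight.mul (continuous_expDamping _)).intervalIntegrable _ _)
      ((ic _).add (ic _)) fun u hu => ?_
    rw [← add_mul, ← mul_add, mul_assoc]
    refine mul_le_mul_of_nonneg_left ?_ (lowWeight_nonneg hu.1)
    unfold expDamping
    have p1 : 7 / 8 * (289 / 200) / L ^ 2 * u ^ 2
        ≤ (1 / L ^ 2 - 1) * ((17 / 10 * u) ^ 2 / 2) := by
      have := mul_le_mul_of_nonneg_right h7 (by positivity : 0 ≤ (17 / 10 * u) ^ 2 / 2)
      refine le_trans (le_of_eq ?_) this
      ring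
    have p2 : 7 / 8 * (9537 / 10000) / L ^ 2 * u ^ 2
        ≤ (1 / L ^ 2 - 1) * ((17 / 10 * u) ^ 2 / 2 - (17 / 10 * u) ^ 3 / 5) := by
      have hq : 9537 / 10000 * u ^ 2 ≤ (17 / 10 * u) ^ 2 / 2 - (17 / 10 * u) ^ 3 / 5 := by
        nlinarith [mul_nonneg (sq_nonneg u) (sub_nonneg.2 hu.2)]
      have := mul_le_mul h7 hq (by positivity) hM0
      refine le_trans (le_of_eq ?_) this
      ring
    have := Real.exp_le_exp.2 (neg_le_neg p1)
    have := Real.exp_le_exp.2 (neg_le_neg p2)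
    linarith
  have hpi := Real.pi_lt_d4
  have l1 := integral_lowWeight_mul_exp_le (k := 7 / 8 * (289 / 200)) (r := 1577 / 1000) hL
    (by norm_num) (by norm_num) (by rw [div_le_iff₀ (by norm_num)]; linarith)
  have l2 := integral_lowWeight_mul_exp_le (k := 7 / 8 * (9537 / 10000)) (r := 1941 / 1000) hL
    (by norm_num) (by norm_num) (by rw [div_le_iff₀ (by norm_num)]; linarith)
  have hhigh1 := integral_highWeight_mul_expDamping_le (a := 1 / 2) (b := 3 / 4) hM0 (by norm_num)
    (by norm_num) (by norm_num) (by norm_num)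
  have hhigh2 := integral_highWeight_mul_expDamping_le (a := 3 / 4) (b := 1) hM0 (by norm_num)
    (by norm_num) (by norm_num) (by norm_num)
  have d1 := expDamping_le_of_small (z := 17 / 10 * (1 / 2)) (q := 894 / 100) hL hL'
    (by norm_num) (by norm_num) (by norm_num)
  have d2 := expDamping_le_of_small (z := 17 / 10 * (3 / 4)) (q := 277 / 100) hL hL'
    (by norm_num) (by norm_num) (by norm_num)
  rw [integral_highWeight] at hhigh1 hhigh2
  rw [← intervalIntegral.integral_add_adjacent_intervals (ih (1 / 2) (3 / 4)) (ih (3 / 4) 1)]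
  have hL3 : 0 < L ^ 3 := by positivity
  have hL4 : 0 < L ^ 4 := by positivity
  norm_num at hlow l1 l2 hhigh1 hhigh2 d1 d2 ⊢
  linarith

theorem smoothing_error_le {L : ℝ} (hL : 0 < L) (hL' : L ^ 2 ≤ 3 / 10) :
    Real.sqrt (Real.pi / 2) * (1 / (17 / 10 / L) + 55 / 100 / (17 / 10 / L) ^ 3)
      - 1 / (17 / 10 / L) ^ 2
      + ((∫ u in (0 : ℝ)..(1 / 2), lowWeight u * expDamping (1 / L ^ 2 - 1) (17 / 10 * u))
        + ∫ u in (1 / 2 : ℝ)..1, highWeight u * expDamping (1 / L ^ 2 - 1) (17 / 10 * u)) / L ^ 2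
      ≤ L := by
  set J := (∫ u in (0 : ℝ)..(1 / 2), lowWeight u * expDamping (1 / L ^ 2 - 1) (17 / 10 * u))
    + ∫ u in (1 / 2 : ℝ)..1, highWeight u * expDamping (1 / L ^ 2 - 1) (17 / 10 * u) with hJ
  have hs : Real.sqrt (Real.pi / 2) ≤ 12534 / 10000 := by
    refine Real.sqrt_le_iff.2 ⟨by norm_num, ?_⟩
    have := Real.pi_lt_d4
    linarith
  have e : Real.sqrt (Real.pi / 2) * (1 / (17 / 10 / L) + 55 / 100 / (17 / 10 / L) ^ 3)
      - 1 / (17 / 10 / L) ^ 2 = Real.sqrt (Real.pi / 2) * (10 / 17 * L + 550 / 4913 * L ^ 3)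
      - 100 / 289 * L ^ 2 := by
    field_simp
    ring
  have h1 := mul_le_mul_of_nonneg_right hs (by positivity : 0 ≤ 10 / 17 * L + 550 / 4913 * L ^ 3)
  have hL2 : 0 < L ^ 2 := by positivity
  suffices h : J / L ^ 2 ≤ L - (12534 / 10000 * (10 / 17 * L + 550 / 4913 * L ^ 3)
      - 100 / 289 * L ^ 2) by
    rw [e]
    linarith
  rw [div_le_iff₀ hL2]
  rcases le_total (L ^ 2) (1 / 8) with h8 | h8
  · refine (integral_error_le_of_small hL h8).trans ?_
    have hl : L ≤ 354 / 1000 := by nlinarith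
    have : 1208 / 10000 + 602 / 1000 * L
        ≤ 1 - 12534 / 10000 * (10 / 17) + 100 / 289 * L - 12534 / 10000 * (550 / 4913) * L ^ 2 := by
      nlinarith
    nlinarith [mul_le_mul_of_nonneg_right this (by positivity : 0 ≤ L ^ 3)]
  · have hM : 7 / 3 ≤ 1 / L ^ 2 - 1 := by
      rw [le_sub_iff_add_le, le_div_iff₀ hL2]
      linarith
    have hM' : 1 / L ^ 2 - 1 ≤ 7 := by
      rw [sub_le_iff_le_add, div_le_iff₀ hL2]
      linarith
    refine (integral_error_le_of_moderate hM hM').trans ?_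
    have hl : 353 / 1000 ≤ L := by nlinarith
    have hl' : L ≤ 548 / 1000 := by nlinarith
    have hJ2 : ((7 - (1 / L ^ 2 - 1)) * (373 / 10000)
        + (1 / L ^ 2 - 1 - 7 / 3) * (122 / 10000)) * (3 / 14) * L ^ 2
        = ((8 * L ^ 2 - 1) * (373 / 10000) + (1 - 10 / 3 * L ^ 2) * (122 / 10000)) * (3 / 14) := by
      field_simp
      ring
    refine le_of_mul_le_mul_right ?_ hL2
    rw [hJ2]
    obtain ⟨d, rfl⟩ : ∃ d, L = 385 / 1000 + d := ⟨L - 385 / 1000, by ring⟩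
    have hd : -33 / 1000 ≤ d := by linarith
    have hd' : d ≤ 164 / 1000 := by linarith
    have f1 : 0 ≤ 36 / 100000 + 6957 / 10000000 * d := by linarith
    have f2 : 0 ≤ 18 / 100 + 677 / 1000 * d - 1 / 10 := by linarith
    have hdd : 0 ≤ d ^ 2 := sq_nonneg d
    have hdd' : d ^ 2 ≤ 1 := by nlinarith
    have f4 : 0 ≤ 9 / 10 + 62 / 100 * d := by linarith
    have f6 : 0 ≤ 2 / 10 - 33 / 1000 - 15 / 100 * d := by linarith
    have g2 := mul_nonneg hdd f2
    have g4 := mul_nonneg (mul_nonneg hdd hdd) f4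
    have g6 := mul_nonneg (mul_nonneg hdd (mul_nonneg hdd hdd)) f6
    nlinarith

theorem gaussQ_antitone : Antitone gaussQ := by
  intro s t hst
  unfold gaussQ
  refine mul_le_mul_of_nonneg_left ?_ (by positivity)
  exact MeasureTheory.setIntegral_mono_set integrable_exp_neg_sq_div_two.integrableOn
    (Filter.Eventually.of_forall fun u => (Real.exp_pos _).le)
    (Set.Ioi_subset_Ioi hst).eventuallyLE

theorem gaussQ_zero : gaussQ 0 = 1 / 2 := by
  simpa using gaussQ_neg_eq 0

theorem gaussQ_le_one (t : ℝ) : gaussQ t ≤ 1 := by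
  have hp := Real.pi_pos
  have h : ∫ u : ℝ, Real.exp (-u ^ 2 / 2) = Real.sqrt (2 * Real.pi) := by
    have := integral_gaussian (1 / 2)
    rw [show Real.pi / (1 / 2) = 2 * Real.pi by ring] at this
    rw [← this]
    congr 1
    funext u
    congr 1
    ring
  have h2 : ∫ u in Set.Ioi t, Real.exp (-u ^ 2 / 2) ≤ Real.sqrt (2 * Real.pi) := by
    rw [← h]
    exact MeasureTheory.setIntegral_le_integral integrable_exp_neg_sq_div_two
      (Filter.Eventually.of_forall fun u => (Real.exp_pos _).le)
  have hs : 0 < Real.sqrt (2 * Real.pi) := Real.sqrt_pos.2 (by positivity)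
  unfold gaussQ
  rw [inv_mul_le_iff₀ hs, mul_one]
  exact h2

theorem gaussQ_neg_le_half_add {x : ℝ} (hx : 0 ≤ x) : gaussQ (-x) ≤ 1 / 2 + 2 / 5 * x := by
  have hs : (Real.sqrt (2 * Real.pi))⁻¹ ≤ 2 / 5 := by
    rw [inv_le_comm₀ (Real.sqrt_pos.2 (by positivity)) (by norm_num)]
    refine Real.le_sqrt_of_sq_le ?_
    linarith [Real.pi_gt_d2]
  have hI : ∫ u in (-x)..0, Real.exp (-u ^ 2 / 2) ≤ x := by
    calc ∫ u in (-x)..0, Real.exp (-u ^ 2 / 2) ≤ ∫ _ in (-x)..0, (1 : ℝ) := by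
          refine intervalIntegral.integral_mono_on (by linarith)
            integrable_exp_neg_sq_div_two.intervalIntegrable (by simp) fun u _ => ?_
          exact Real.exp_le_one_iff.2 (by nlinarith [sq_nonneg u])
      _ = x := by simp
  have hadd := intervalIntegral.integral_interval_add_Ioi (a := -x) (b := 0)
    integrable_exp_neg_sq_div_two.integrableOn integrable_exp_neg_sq_div_two.integrableOn
  have h0 := gaussQ_zero
  unfold gaussQ at h0 ⊢
  rw [← hadd, mul_add, h0]
  have := mul_le_mul hs hI (intervalIntegral.integral_nonneg (by linarith)
    fun u _ => (Real.exp_pos _).le) (by norm_num)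
  linarith

theorem one_sub_inv_le_sum_of_moments {ι : Type*} [Fintype ι] {w s : ι → ℝ} (hw : ∀ i, 0 ≤ w i)
    (h1 : ∑ i, w i = 1) (h0 : ∑ i, w i * s i = 0) (h2 : ∑ i, w i * s i ^ 2 = 1) {x : ℝ}
    (hx : 0 ≤ x) : 1 - 1 / (1 + x ^ 2) ≤ ∑ i, w i * (if s i ≤ x then 1 else 0) := by
  have hc : 0 < 1 + x ^ 2 := by positivity
  have key : ∀ i, w i * (1 - ((x * s i + 1) / (1 + x ^ 2)) ^ 2)
      ≤ w i * (if s i ≤ x then 1 else 0) := by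
    refine fun i => mul_le_mul_of_nonneg_left ?_ (hw i)
    split_ifs with h
    · linarith [sq_nonneg ((x * s i + 1) / (1 + x ^ 2))]
    · have : 1 ≤ (x * s i + 1) / (1 + x ^ 2) := by
        rw [le_div_iff₀ hc]
        nlinarith
      nlinarith
  refine le_trans (le_of_eq ?_) (Finset.sum_le_sum fun i _ => key i)
  have e : ∀ i, w i * (1 - ((x * s i + 1) / (1 + x ^ 2)) ^ 2)
      = w i - (x ^ 2 * (w i * s i ^ 2) + 2 * x * (w i * s i) + w i) / (1 + x ^ 2) ^ 2 := by
    intro i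
    field_simp
    ring
  simp only [e, Finset.sum_sub_distrib, ← Finset.sum_div, Finset.sum_add_distrib,
    ← Finset.mul_sum, h0, h1, h2]
  field_simp
  ring

theorem gaussQ_neg_le_add_of_moments {ι : Type*} [Fintype ι] {w s : ι → ℝ} (hw : ∀ i, 0 ≤ w i)
    (h1 : ∑ i, w i = 1) (h0 : ∑ i, w i * s i = 0) (h2 : ∑ i, w i * s i ^ 2 = 1) (x : ℝ) {L : ℝ}
    (hL : 0 < L) (hL' : 3 / 10 ≤ L ^ 2) :
    gaussQ (-x) ≤ ∑ i, w i * (if s i ≤ x then 1 else 0) + L := by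
  have hl : 547 / 1000 ≤ L := by nlinarith
  have hP : 0 ≤ ∑ i, w i * (if s i ≤ x then (1 : ℝ) else 0) :=
    Finset.sum_nonneg fun i _ => mul_nonneg (hw i) (by split_ifs <;> norm_num)
  rcases le_total x 0 with hx | hx
  · have := gaussQ_antitone (neg_nonneg.2 hx)
    rw [gaussQ_zero] at this
    linarith
  · have hc := one_sub_inv_le_sum_of_moments hw h1 h0 h2 hx
    have hc0 : 0 < 1 + x ^ 2 := by positivity
    rcases le_total x 1 with hx1 | hx1
    · have hq := gaussQ_neg_le_half_add hx
      have : 1 / (1 + x ^ 2) ≤ 1 / 2 - 2 / 5 * x + 547 / 1000 := by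
        rw [div_le_iff₀ hc0]
        nlinarith [mul_nonneg hx (sq_nonneg (x - 22 / 100)), mul_nonneg hx (sub_nonneg.2 hx1),
          sq_nonneg (x - 22 / 100), mul_nonneg (sq_nonneg x) (sub_nonneg.2 hx1)]
      linarith
    · have hq := gaussQ_le_one (-x)
      have : 1 / (1 + x ^ 2) ≤ 547 / 1000 := by
        rw [div_le_iff₀ hc0]
        nlinarith
      linarith

theorem gaussQ_neg_le_add_of_norm_sub_le {ι : Type*} [Fintype ι] {w s : ι → ℝ}
    (hw : ∀ i, 0 ≤ w i) (h1 : ∑ i, w i = 1) (x : ℝ) {L : ℝ} (hL : 0 < L) (hL' : L ^ 2 ≤ 3 / 10)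
    (hf : ∀ z, 0 ≤ z → z ≤ 5 / 2 →
      ‖finCharFun w s (z / L) - (Real.exp (-((z / L) ^ 2 / 2)) : ℝ)‖
        ≤ (z ^ 3 / 6 + z ^ 4 / 8) / L ^ 2 * expDamping (1 / L ^ 2 - 1) z) :
    gaussQ (-x) ≤ ∑ i, w i * (if s i ≤ x then 1 else 0) + L := by
  set M := 1 / L ^ 2 - 1 with hM
  set E₁ : ℝ → ℝ := fun u => lowWeight u * expDamping M (17 / 10 * u) / L ^ 2 with hE₁
  set E₂ : ℝ → ℝ := fun u => highWeight u * expDamping M (17 / 10 * u) / L ^ 2 with hE₂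
  set E : ℝ → ℝ := fun u => if u ≤ 1 / 2 then E₁ u else E₂ u with hE
  have c₁ : Continuous E₁ := (continuous_lowWeight.mul (continuous_expDamping M)).div_const _
  have c₂ : Continuous E₂ := (continuous_highWeight.mul (continuous_expDamping M)).div_const _
  have e₁ : Set.EqOn E₁ E (Set.uIoc 0 (1 / 2)) := by
    intro u hu
    rw [Set.uIoc_of_le (by norm_num)] at hu
    exact (if_pos hu.2).symm
  have e₂ : Set.EqOn E₂ E (Set.uIoc (1 / 2) 1) := by
    intro u hu
    rw [Set.uIoc_of_le (by norm_num)] at hu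
    exact (if_neg (not_le.2 hu.1)).symm
  have i₁ : IntervalIntegrable E MeasureTheory.volume 0 (1 / 2) :=
    (intervalIntegrable_congr e₁).1 (c₁.intervalIntegrable _ _)
  have i₂ : IntervalIntegrable E MeasureTheory.volume (1 / 2) 1 :=
    (intervalIntegrable_congr e₂).1 (c₂.intervalIntegrable _ _)
  have hI : ∫ u in (0 : ℝ)..1, E u = ((∫ u in (0 : ℝ)..(1 / 2), lowWeight u
      * expDamping M (17 / 10 * u)) + ∫ u in (1 / 2 : ℝ)..1, highWeight u
      * expDamping M (17 / 10 * u)) / L ^ 2 := by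
    rw [← intervalIntegral.integral_add_adjacent_intervals i₁ i₂,
      ← intervalIntegral.integral_congr_ae (Filter.Eventually.of_forall e₁),
      ← intervalIntegral.integral_congr_ae (Filter.Eventually.of_forall e₂),
      intervalIntegral.integral_div, intervalIntegral.integral_div, add_div]
  have hb : ∀ u k : ℝ, 0 < u → u < 1 → 0 ≤ k →
      k * ‖finCharFun w s (u * (17 / 10 / L))
        - (Real.exp (-((u * (17 / 10 / L)) ^ 2 / 2)) : ℝ)‖
      ≤ k * (4913 / 6000 * u ^ 3 + 83521 / 80000 * u ^ 4) * expDamping M (17 / 10 * u)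
        / L ^ 2 := by
    intro u k hu hu' hk
    have h := mul_le_mul_of_nonneg_left (hf (17 / 10 * u) (by positivity) (by linarith)) hk
    rw [show u * (17 / 10 / L) = 17 / 10 * u / L by ring]
    refine h.trans (le_of_eq ?_)
    ring
  have main := gaussQ_neg_le_of_finCharFun (s := s) hw h1 x (T := 17 / 10 / L) (by positivity)
    (i₁.trans i₂) ?_
  · have := smoothing_error_le hL hL'
    rw [hI] at main
    linarith
  · intro u hu hu'
    rcases le_or_gt u (1 / 2) with h | h
    · refine ⟨33 / 100 / u, by positivity, prawitzKernel_sq_le_of_le_half hu h, ?_⟩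
      refine (hb u _ hu hu' (by positivity)).trans (le_of_eq ?_)
      rw [hE]
      simp only [if_pos h, hE₁, lowWeight]
      field_simp
    · have := sub_pos.2 hu'
      refine ⟨(1 - u) * (1 + (1 - u) ^ 2), by positivity,
        prawitzKernel_sq_le_of_half_le h.le hu', ?_⟩
      refine (hb u _ hu hu' (by positivity)).trans (le_of_eq ?_)
      rw [hE]
      simp only [if_neg (not_le.2 h), hE₂, highWeight]

theorem finCharFun_prod {Ω : Type*} [Fintype Ω] (p a : Ω → ℝ) (n : ℕ) (v : ℝ) :
    finCharFun (fun ω : Fin n → Ω => ∏ i, p (ω i)) (fun ω => (∑ i, a (ω i)) / Real.sqrt n) v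
      = finCharFun p a (v / Real.sqrt n) ^ n := by
  classical
  unfold finCharFun
  rw [Fintype.sum_pow]
  refine Finset.sum_congr rfl fun ω _ => ?_
  rw [Finset.prod_mul_distrib, ← Complex.exp_sum]
  push_cast
  congr 2
  rw [Finset.sum_div, Finset.mul_sum, Finset.sum_mul]
  refine Finset.sum_congr rfl fun i _ => ?_
  ring

theorem sum_fin_succ_fun {Ω : Type*} [Fintype Ω] (n : ℕ) (F : (Fin (n + 1) → Ω) → ℝ) :
    ∑ ω, F ω = ∑ x, ∑ ω : Fin n → Ω, F (Fin.cons x ω) := by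
  rw [← (Fin.consEquiv fun _ : Fin (n + 1) => Ω).sum_comp, Fintype.sum_prod_type]
  rfl

theorem sum_prod_mul_moments {Ω : Type*} [Fintype Ω] {p a : Ω → ℝ} (h1 : ∑ ω, p ω = 1)
    (h0 : ∑ ω, p ω * a ω = 0) (h2 : ∑ ω, p ω * a ω ^ 2 = 1) (n : ℕ) :
    ∑ ω : Fin n → Ω, ∏ i, p (ω i) = 1 ∧
    ∑ ω : Fin n → Ω, (∏ i, p (ω i)) * ∑ i, a (ω i) = 0 ∧
    ∑ ω : Fin n → Ω, (∏ i, p (ω i)) * (∑ i, a (ω i)) ^ 2 = n := by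
  induction n with
  | zero => simp
  | succ n ih =>
    obtain ⟨g1, g0, g2⟩ := ih
    simp only [sum_fin_succ_fun, Fin.prod_univ_succ, Fin.sum_univ_succ, Fin.cons_zero,
      Fin.cons_succ]
    have e0 : ∀ x (ω : Fin n → Ω), p x * (∏ i, p (ω i)) * (a x + ∑ i, a (ω i))
        = p x * a x * (∏ i, p (ω i)) + p x * ((∏ i, p (ω i)) * ∑ i, a (ω i)) := by
      intros
      ring
    have e2 : ∀ x (ω : Fin n → Ω), p x * (∏ i, p (ω i)) * (a x + ∑ i, a (ω i)) ^ 2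
        = p x * a x ^ 2 * (∏ i, p (ω i)) + 2 * (p x * a x) * ((∏ i, p (ω i)) * ∑ i, a (ω i))
          + p x * ((∏ i, p (ω i)) * (∑ i, a (ω i)) ^ 2) := by
      intros
      ring
    simp only [e0, e2, Finset.sum_add_distrib, ← Finset.mul_sum, g0, g1, g2, mul_one, mul_zero,
      add_zero, h1, h0, h2, ← Finset.sum_mul]
    refine ⟨trivial, trivial, ?_⟩
    push_cast
    ring

/-- One-sided Berry–Esseen inequality with constant one for a finitely supported law. -/
theorem gaussQ_neg_le_sum_add_div_sqrt {Ω : Type*} [Fintype Ω] {p a : Ω → ℝ} (hp : ∀ ω, 0 ≤ p ω)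
    (h1 : ∑ ω, p ω = 1) (h0 : ∑ ω, p ω * a ω = 0) (h2 : ∑ ω, p ω * a ω ^ 2 = 1) {n : ℕ}
    (hn : 0 < n) (x : ℝ) :
    gaussQ (-x) ≤ ∑ ω : Fin n → Ω, (∏ i, p (ω i))
        * (if (∑ i, a (ω i)) / Real.sqrt n ≤ x then 1 else 0)
      + (∑ ω, p ω * |a ω| ^ 3) / Real.sqrt n := by
  set L := (∑ ω, p ω * |a ω| ^ 3) / Real.sqrt n with hLdef
  have hn0 : 0 < Real.sqrt n := Real.sqrt_pos.2 (by exact_mod_cast hn)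
  have hL : 0 < L := div_pos (lt_of_lt_of_le one_pos (one_le_sum_mul_abs_cube hp h1 h2)) hn0
  have hw : ∀ ω : Fin n → Ω, 0 ≤ ∏ i, p (ω i) := fun ω => Finset.prod_nonneg fun i _ => hp _
  obtain ⟨g1, g0, g2⟩ := sum_prod_mul_moments h1 h0 h2 n
  rcases le_total (L ^ 2) (3 / 10) with hL' | hL'
  · refine gaussQ_neg_le_add_of_norm_sub_le (s := fun ω : Fin n → Ω => (∑ i, a (ω i)) / √n)
      hw g1 x hL hL' fun z hz hz' => ?_
    rw [finCharFun_prod, div_div]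
    exact norm_finCharFun_pow_sub_le hp h1 h0 h2 hn hLdef hz hz'
  · refine gaussQ_neg_le_add_of_moments (s := fun ω : Fin n → Ω => (∑ i, a (ω i)) / √n)
      hw g1 ?_ ?_ x hL hL'
    · simp only [← mul_div_assoc, ← Finset.sum_div, g0, zero_div]
    · simp only [div_pow, ← mul_div_assoc, ← Finset.sum_div, g2]
      rw [Real.sq_sqrt (Nat.cast_nonneg n), div_self (by positivity)]

theorem sum_arrow_prod {ι X Y : Type*} [Fintype ι] [DecidableEq ι] [Fintype X] [Fintype Y]
    (F : (ι → X × Y) → ℝ) :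
    ∑ ω, F ω = ∑ xs : ι → X, ∑ ys : ι → Y, F fun i => (xs i, ys i) := by
  rw [← (Equiv.arrowProdEquivProdArrow ι (fun _ => X) (fun _ => Y)).symm.sum_comp,
    Fintype.sum_prod_type]
  rfl

theorem prod_le_prod_mul_exp_of_sum_log_le {ι : Type*} [Fintype ι] {p q : ι → ℝ}
    (hp : ∀ i, 0 ≤ p i) (hpq : ∀ i, p i ≤ q i) {c : ℝ}
    (h : ∑ i, Real.log (p i / q i) ≤ c) : ∏ i, p i ≤ (∏ i, q i) * Real.exp c := by
  have hq : ∀ i, 0 ≤ q i := fun i => (hp i).trans (hpq i)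
  by_cases h0 : ∃ i, p i = 0
  · obtain ⟨i, hi⟩ := h0
    rw [Finset.prod_eq_zero (Finset.mem_univ i) hi]
    exact mul_nonneg (Finset.prod_nonneg fun i _ => hq i) (Real.exp_pos c).le
  · push Not at h0
    have hp' : ∀ i, 0 < p i := fun i => lt_of_le_of_ne (hp i) (h0 i).symm
    have hq' : ∀ i, 0 < q i := fun i => (hp' i).trans_le (hpq i)
    have e : ∏ i, p i = (∏ i, q i) * Real.exp (∑ i, Real.log (p i / q i)) := by
      rw [Real.exp_sum, ← Finset.prod_mul_distrib]
      refine Finset.prod_congr rfl fun i _ => ?_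
      rw [Real.exp_log (div_pos (hp' i) (hq' i)), mul_div_cancel₀ _ (hq' i).ne']
    rw [e]
    exact mul_le_mul_of_nonneg_left (Real.exp_le_exp.2 h) (Finset.prod_nonneg fun i _ => hq i)

/-- The information-spectrum bound on the probability of a small conditional likelihood. -/
theorem sum_prod_mul_indicator_log_le {ι X Y : Type*} [Fintype ι] [DecidableEq ι] [Fintype X]
    [Fintype Y] [DecidableEq Y] {P : X → Y → ℝ} (hP : ∀ x y, 0 ≤ P x y)
    (Γ : (ι → X) → Finset (ι → Y)) (c : ℝ) :
    ∑ xs : ι → X, ∑ ys : ι → Y, (∏ i, P (xs i) (ys i))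
        * (if ∑ i, Real.log (P (xs i) (ys i) / ∑ y, P (xs i) y) ≤ c then 1 else 0)
      ≤ ∑ xs : ι → X, ∑ ys : ι → Y, (∏ i, P (xs i) (ys i)) * (if ys ∈ Γ xs then 0 else 1)
        + Real.exp c * ∑ xs : ι → X, (∏ i, ∑ y, P (xs i) y) * ((Γ xs).card : ℝ) := by
  rw [Finset.mul_sum, ← Finset.sum_add_distrib]
  refine Finset.sum_le_sum fun xs _ => ?_
  have hcard : ((Γ xs).card : ℝ) = ∑ ys : ι → Y, if ys ∈ Γ xs then 1 else 0 := by
    simp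
  rw [hcard, Finset.mul_sum, Finset.mul_sum, ← Finset.sum_add_distrib]
  refine Finset.sum_le_sum fun ys _ => ?_
  have hp : 0 ≤ ∏ i, P (xs i) (ys i) := Finset.prod_nonneg fun i _ => hP _ _
  have hq : 0 ≤ ∏ i, ∑ y, P (xs i) y :=
    Finset.prod_nonneg fun i _ => Finset.sum_nonneg fun y _ => hP _ _
  by_cases hm : ys ∈ Γ xs
  · simp only [if_pos hm, mul_zero, zero_add, mul_one]
    split_ifs with h
    · have := prod_le_prod_mul_exp_of_sum_log_le (fun i => hP (xs i) (ys i))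
        (fun i => Finset.single_le_sum (f := fun y => P (xs i) y) (fun y _ => hP (xs i) y)
          (Finset.mem_univ (ys i))) h
      linarith
    · rw [mul_zero]
      positivity
  · simp only [if_neg hm, mul_zero, add_zero, mul_one]
    split_ifs <;> linarith

/-- **non-asymptotic converse.** Let `(X_i,Y_i)` be i.i.d. from a finite
joint distribution `P` with conditional entropy `H`, dispersion `σ > 0` and third
absolute moment `ρ` of `log P(Y|X)`. If a set predictor `Γ` on `n` samples has error
probability at most `α`, then for any `Δ > 0` and `t = Q⁻¹(α + ρ/(√n σ³) + Δ)`
(i.e. `gaussQ t = α + ρ/(√n σ³) + Δ`, which forces this value to lie in `(0,1)`),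
`log E[|Γ|] ≥ log Δ + n·H + √n·σ·t`. -/
theorem nonasymptotic_efficiency_confidence_tradeoff
    {X Y : Type*} [Fintype X] [Fintype Y] [DecidableEq Y]
    (P : X → Y → ℝ) (hPnonneg : ∀ x y, 0 ≤ P x y)
    (hPsum : ∑ x, ∑ y, P x y = 1)
    (H σ ρ : ℝ)
    (hH : H = -∑ x, ∑ y, P x y * Real.log (P x y / ∑ y', P x y'))
    (hσ : σ ^ 2 = ∑ x, ∑ y, P x y * (Real.log (P x y / ∑ y', P x y') + H) ^ 2)
    (hσpos : 0 < σ)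
    (hρ : ρ = ∑ x, ∑ y, P x y * |Real.log (P x y / ∑ y', P x y') + H| ^ 3)
    (n : ℕ) (hn : 0 < n)
    (Γ : (Fin n → X) → Finset (Fin n → Y))
    (α : ℝ)
    (herr : ∑ xs : Fin n → X, ∑ ys : Fin n → Y,
        (∏ i, P (xs i) (ys i)) * (if ys ∈ Γ xs then 0 else 1) ≤ α)
    (Δ t : ℝ) (hΔ : 0 < Δ)
    (ht : gaussQ t = α + ρ / (Real.sqrt n * σ ^ 3) + Δ) :
    Real.log Δ + n * H + Real.sqrt n * σ * t ≤
      Real.log (∑ xs : Fin n → X, (∏ i, ∑ y, P (xs i) y) * ((Γ xs).card : ℝ)) := by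
  have hs : 0 < Real.sqrt n := Real.sqrt_pos.2 (by exact_mod_cast hn)
  have hss : Real.sqrt n * Real.sqrt n = n := Real.mul_self_sqrt (Nat.cast_nonneg n)
  set l : X × Y → ℝ := fun ω => Real.log (P ω.1 ω.2 / ∑ y', P ω.1 y') with hl
  set p : X × Y → ℝ := fun ω => P ω.1 ω.2 with hp
  have h1 : ∑ ω, p ω = 1 := by rw [Fintype.sum_prod_type, ← hPsum]
  have hH' : ∑ ω, p ω * l ω = -H := by rw [Fintype.sum_prod_type, hH, neg_neg]
  have hσ' : ∑ ω, p ω * (l ω + H) ^ 2 = σ ^ 2 := by rw [Fintype.sum_prod_type, hσ]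
  have hρ' : ∑ ω, p ω * |l ω + H| ^ 3 = ρ := by rw [Fintype.sum_prod_type, hρ]
  have m1 : ∑ ω, p ω * ((l ω + H) / σ) = 0 := by
    simp only [← mul_div_assoc, ← Finset.sum_div, mul_add, Finset.sum_add_distrib,
      ← Finset.sum_mul, h1, hH']
    ring
  have m2 : ∑ ω, p ω * ((l ω + H) / σ) ^ 2 = 1 := by
    simp only [div_pow, ← mul_div_assoc, ← Finset.sum_div, hσ']
    exact div_self (by positivity)
  have m3 : ∑ ω, p ω * |(l ω + H) / σ| ^ 3 = ρ / σ ^ 3 := by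
    simp only [abs_div, abs_of_pos hσpos, div_pow, ← mul_div_assoc, ← Finset.sum_div, hρ']
  have hbe := gaussQ_neg_le_sum_add_div_sqrt (p := p) (fun ω => hPnonneg ω.1 ω.2) h1 m1 m2 hn (-t)
  rw [neg_neg, ht, m3, div_div, mul_comm (σ ^ 3), sum_arrow_prod] at hbe
  have hiff : ∀ ω : Fin n → X × Y, (∑ i, (l (ω i) + H) / σ) / Real.sqrt n ≤ -t ↔
      ∑ i, l (ω i) ≤ -(n * H + Real.sqrt n * σ * t) := by
    intro ω
    rw [← Finset.sum_div, Finset.sum_add_distrib, Finset.sum_const, Finset.card_univ,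
      Fintype.card_fin, nsmul_eq_mul, div_div, div_le_iff₀ (mul_pos hσpos hs)]
    constructor <;> intro h <;> linarith
  simp only [hiff] at hbe
  have hspec := sum_prod_mul_indicator_log_le hPnonneg Γ (-(n * H + Real.sqrt n * σ * t))
  set S := ∑ xs : Fin n → X, (∏ i, ∑ y, P (xs i) y) * ((Γ xs).card : ℝ)
  have hΔS : Δ ≤ Real.exp (-(n * H + Real.sqrt n * σ * t)) * S := by
    simp only [hl, hp] at hbe
    linarith
  have hS : 0 < S := pos_of_mul_pos_right (hΔ.trans_le hΔS) (Real.exp_pos _).le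
  have hlog := Real.log_le_log hΔ hΔS
  rw [Real.log_mul (Real.exp_pos _).ne' hS.ne', Real.log_exp] at hlog
  linarith
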